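/- arXiv:1903.01880 — 2 statements merged into one kernel-verified Lean document; each statement's English description precedes it below -/
import Mathlib

section
/- Let v ∈ ℝ with |v| ≥ 1 and suppose Q_v ∈ Ḣ^{1/2}(ℝ; S²) solves the traveling-wave equation Q_v × |∇|Q_v + v ∂_x Q_v = 0 (in the distributional sense). Then Q_v is constant: there exists a point P ∈ S² with Q_v(x) = P for a.e. x ∈ ℝ. -/
/-!
Traveling solitary waves for the half-wave maps equation with speed |v| ≥ 1
are trivial (constant).  Same weak formulation as in the subluminal case.
-/

open MeasureTheory Filter
open scoped ENNReal Topology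

noncomputable section

/-- Vectors in ℝ³. -/
abbrev V3 : Type := Fin 3 → ℝ

/-- Euclidean dot product on ℝ³. -/
def dot3 (a b : V3) : ℝ := ∑ i, a i * b i

/-- Cross product on ℝ³. -/
def cross3 (a b : V3) : V3 := crossProduct a b

/-- The traveling-wave equation `Q × |∇|Q + v ∂ₓ Q = 0` in the weak
(distributional) sense, tested against Schwartz functions (the `|∇|`-pairing is
expressed through the `Ḣ^{1/2}` bilinear form). -/
def WeakTravelingWave (v : ℝ) (Q : ℝ → V3) : Prop :=
  ∀ φ : SchwartzMap ℝ V3,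
    (1 / (2 * Real.pi)) *
        ∫ x : ℝ, ∫ y : ℝ,
          dot3 (Q x - Q y) (cross3 (φ x) (Q x) - cross3 (φ y) (Q y)) / (x - y) ^ 2
      = v * ∫ x : ℝ, dot3 (Q x) (deriv (fun t => φ t) x)

section

open scoped SchwartzMap FourierTransform ComplexConjugate

theorem integral_exp_neg_mul_one_sub_cos {t : ℝ} (ht : 0 < t) (s : ℝ) :
    IntegrableOn (fun h : ℝ => Real.exp (-(t * h)) * (1 - Real.cos (h * s))) (Set.Ioi 0) ∧
    ∫ h in Set.Ioi (0 : ℝ), Real.exp (-(t * h)) * (1 - Real.cos (h * s))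
      = s ^ 2 / (t * (t ^ 2 + s ^ 2)) := by
  have key : ∀ r : ℝ, IntegrableOn (fun h : ℝ => Real.exp (-(t * h)) * Real.cos (h * r))
        (Set.Ioi 0) ∧
      ∫ h in Set.Ioi (0 : ℝ), Real.exp (-(t * h)) * Real.cos (h * r) = t / (t ^ 2 + r ^ 2) := by
    intro r
    have hre : (⟨-t, r⟩ : ℂ).re < 0 := by simpa using ht
    have h1 := integrableOn_exp_mul_complex_Ioi hre 0
    have h2 := integral_exp_mul_complex_Ioi hre 0
    have heq : ∀ h : ℝ, (Complex.exp ((⟨-t, r⟩ : ℂ) * h)).re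
        = Real.exp (-(t * h)) * Real.cos (h * r) := by
      intro h
      rw [Complex.exp_re]
      simp [mul_comm]
    refine ⟨h1.re.congr (Eventually.of_forall heq), ?_⟩
    have h3 := integral_re h1.integrable
    simp only [RCLike.re_to_complex, h2, heq] at h3
    rw [h3]
    simp [Complex.neg_re, Complex.div_re, Complex.normSq_apply]
    ring
  obtain ⟨i0, e0⟩ := key 0
  obtain ⟨i1, e1⟩ := key s
  simp only [mul_zero, Real.cos_zero, mul_one] at i0 e0
  have hsub : (fun h : ℝ => Real.exp (-(t * h)) * (1 - Real.cos (h * s)))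
      = fun h => Real.exp (-(t * h)) - Real.exp (-(t * h)) * Real.cos (h * s) := by
    ext h; ring
  rw [hsub]
  refine ⟨i0.sub i1, ?_⟩
  rw [integral_sub i0 i1, e0, e1]
  have : 0 < t ^ 2 + s ^ 2 := by positivity
  field_simp
  ring

theorem lintegral_mul_exp_neg {h : ℝ} (hh : 0 < h) :
    ∫⁻ t in Set.Ioi (0 : ℝ), ENNReal.ofReal (t * Real.exp (-(t * h)))
      = ENNReal.ofReal (1 / h ^ 2) := by
  have h1 := Real.integral_rpow_mul_exp_neg_mul_Ioi (a := 2) (by norm_num) hh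
  have e : ∀ t : ℝ, t ^ ((2 : ℝ) - 1) * Real.exp (-(h * t)) = t * Real.exp (-(t * h)) := by
    intro t
    rw [show (2 : ℝ) - 1 = 1 by norm_num, Real.rpow_one, mul_comm h]
  simp only [e] at h1
  have h2 : (1 / h) ^ (2 : ℝ) * Real.Gamma 2 = 1 / h ^ 2 := by
    rw [Real.Gamma_two, Real.rpow_two]; ring
  rw [h2] at h1
  rw [← h1, ofReal_integral_eq_lintegral_ofReal]
  · exact .of_integral_ne_zero (by rw [h1]; positivity)
  · filter_upwards [ae_restrict_mem measurableSet_Ioi] with t ht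
    have : 0 < t := ht
    simp only [Pi.zero_apply]
    positivity

theorem lintegral_sq_div_sq_add_sq {s : ℝ} (hs : 0 < s) :
    ∫⁻ t in Set.Ioi (0 : ℝ), ENNReal.ofReal (s ^ 2 / (t ^ 2 + s ^ 2))
      = ENNReal.ofReal (s * (Real.pi / 2)) := by
  have hd : ∀ t ∈ Set.Ici (0 : ℝ),
      HasDerivAt (fun t => s * Real.arctan (t / s)) (s ^ 2 / (t ^ 2 + s ^ 2)) t := by
    intro t _
    have := (((hasDerivAt_id t).div_const s).arctan).const_mul s
    refine this.congr_deriv ?_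
    have : 0 < t ^ 2 + s ^ 2 := by positivity
    simp only [id]
    field_simp
    ring
  have hp : ∀ t ∈ Set.Ioi (0 : ℝ), 0 ≤ s ^ 2 / (t ^ 2 + s ^ 2) := fun t _ => by positivity
  have hl : Tendsto (fun t => s * Real.arctan (t / s)) atTop (𝓝 (s * (Real.pi / 2))) :=
    ((tendsto_nhds_of_tendsto_nhdsWithin Real.tendsto_arctan_atTop).comp
      (tendsto_id.atTop_div_const hs)).const_mul s
  have h1 := integral_Ioi_of_hasDerivAt_of_nonneg' hd hp hl
  rw [zero_div, Real.arctan_zero, mul_zero, sub_zero] at h1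
  rw [← h1, ofReal_integral_eq_lintegral_ofReal]
  · exact integrableOn_Ioi_deriv_of_nonneg' hd hp hl
  · exact Eventually.of_forall fun t => by simp only [Pi.zero_apply]; positivity

theorem lintegral_Ioi_one_sub_cos_div_sq {s : ℝ} (hs : 0 < s) :
    ∫⁻ h in Set.Ioi (0 : ℝ), ENNReal.ofReal ((1 - Real.cos (h * s)) / h ^ 2)
      = ENNReal.ofReal (s * (Real.pi / 2)) := by
  have h0 : ∀ x : ℝ, 0 ≤ 1 - Real.cos x := fun x => sub_nonneg.2 (Real.cos_le_one x)
  calc ∫⁻ h in Set.Ioi (0 : ℝ), ENNReal.ofReal ((1 - Real.cos (h * s)) / h ^ 2)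
      = ∫⁻ h in Set.Ioi (0 : ℝ), ∫⁻ t in Set.Ioi (0 : ℝ),
          ENNReal.ofReal (1 - Real.cos (h * s)) * ENNReal.ofReal (t * Real.exp (-(t * h))) := by
        refine setLIntegral_congr_fun measurableSet_Ioi fun h hh => ?_
        rw [lintegral_const_mul _ (by fun_prop), lintegral_mul_exp_neg hh,
          ← ENNReal.ofReal_mul (h0 _)]
        congr 1; ring
    _ = ∫⁻ t in Set.Ioi (0 : ℝ), ∫⁻ h in Set.Ioi (0 : ℝ),
          ENNReal.ofReal (1 - Real.cos (h * s)) * ENNReal.ofReal (t * Real.exp (-(t * h))) :=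
        lintegral_lintegral_swap (by fun_prop)
    _ = ∫⁻ t in Set.Ioi (0 : ℝ), ENNReal.ofReal (s ^ 2 / (t ^ 2 + s ^ 2)) := by
        refine setLIntegral_congr_fun measurableSet_Ioi fun t ht => ?_
        have ht' : 0 < t := ht
        obtain ⟨hi, he⟩ := integral_exp_neg_mul_one_sub_cos ht' s
        have : ∀ h : ℝ, ENNReal.ofReal (1 - Real.cos (h * s)) *
            ENNReal.ofReal (t * Real.exp (-(t * h))) =
            ENNReal.ofReal t * ENNReal.ofReal (Real.exp (-(t * h)) * (1 - Real.cos (h * s))) := by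
          intro h
          rw [← ENNReal.ofReal_mul (h0 _), ← ENNReal.ofReal_mul ht'.le]
          congr 1; ring
        simp only [this]
        rw [lintegral_const_mul _ (by fun_prop), ← ofReal_integral_eq_lintegral_ofReal hi
          (Eventually.of_forall fun h => mul_nonneg (Real.exp_pos _).le (h0 _)), he,
          ← ENNReal.ofReal_mul ht'.le]
        congr 1
        have : 0 < t ^ 2 + s ^ 2 := by positivity
        field_simp
    _ = _ := lintegral_sq_div_sq_add_sq hs

/-- The Gagliardo symbol of `|∇|` in dimension one. -/
theorem lintegral_two_sub_two_cos_div_sq (s : ℝ) :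
    ∫⁻ h : ℝ, ENNReal.ofReal ((2 - 2 * Real.cos (h * s)) / h ^ 2)
      = ENNReal.ofReal (2 * Real.pi * |s|) := by
  rcases eq_or_ne s 0 with rfl | hs
  · simp
  have hs' : 0 < |s| := abs_pos.2 hs
  have e : ∀ h : ℝ, (2 - 2 * Real.cos (h * s)) / h ^ 2
      = 2 * ((1 - Real.cos (h * |s|)) / h ^ 2) := by
    intro h
    rw [← Real.cos_abs (h * s), ← Real.cos_abs (h * |s|), abs_mul, abs_mul, abs_abs]
    ring
  simp only [e, ENNReal.ofReal_mul (show (0 : ℝ) ≤ 2 by norm_num)]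
  rw [lintegral_const_mul _ (by fun_prop)]
  set f : ℝ → ℝ≥0∞ := fun h => ENNReal.ofReal ((1 - Real.cos (h * |s|)) / h ^ 2) with hf
  have heven : ∀ h, f (-h) = f h := fun h => by simp [hf]
  have hneg : ∫⁻ h in Set.Iic (0 : ℝ), f h = ∫⁻ h in Set.Ioi (0 : ℝ), f h := by
    have := (Measure.measurePreserving_neg (volume : Measure ℝ)).setLIntegral_comp_preimage_emb
      (MeasurableEquiv.neg ℝ).measurableEmbedding f (Set.Ici 0)
    simp only [heven, Set.neg_preimage, Set.neg_Ici, neg_zero] at this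
    rw [this]
    exact setLIntegral_congr Ioi_ae_eq_Ici.symm
  rw [← lintegral_add_compl f (measurableSet_Ioi (a := (0 : ℝ))), Set.compl_Ioi, hneg,
    lintegral_Ioi_one_sub_cos_div_sq hs', ← ENNReal.ofReal_add (by positivity) (by positivity),
    ← ENNReal.ofReal_mul (by norm_num)]
  congr 1; ring

/-- The squared Gagliardo seminorm of order one half on the line. -/
def gagliardoSq {E : Type*} [NormedAddCommGroup E] (f : ℝ → E) : ℝ≥0∞ :=
  ∫⁻ x, ∫⁻ y, ENNReal.ofReal (‖f x - f y‖ ^ 2 / (x - y) ^ 2)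

theorem lintegral_lintegral_eq_diff {F : ℝ → ℝ → ℝ≥0∞} (hF : Measurable (Function.uncurry F)) :
    ∫⁻ x, ∫⁻ y, F x y = ∫⁻ h, ∫⁻ x, F (x + h) x := by
  rw [lintegral_lintegral_swap hF.aemeasurable]
  have : ∀ y, ∫⁻ x, F x y = ∫⁻ h, F (y + h) y := fun y =>
    (lintegral_add_left_eq_self (fun x => F x y) y).symm
  simp only [this]
  refine lintegral_lintegral_swap (Measurable.aemeasurable ?_)
  exact hF.comp (by fun_prop : Measurable fun p : ℝ × ℝ => (p.1 + p.2, p.1))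

theorem gagliardoSq_eq_lintegral_diff {E : Type*} [NormedAddCommGroup E] [MeasurableSpace E]
    [BorelSpace E] [SecondCountableTopology E] {f : ℝ → E} (hf : Measurable f) :
    gagliardoSq f =
      ∫⁻ h, ENNReal.ofReal (1 / h ^ 2) * ∫⁻ x, ‖f (x + h) - f x‖ₑ ^ 2 := by
  unfold gagliardoSq
  rw [lintegral_lintegral_eq_diff]
  · refine lintegral_congr fun h => ?_
    rw [← lintegral_const_mul _ (by fun_prop)]
    refine lintegral_congr fun x => ?_
    rw [← ofReal_norm, ← ENNReal.ofReal_pow (norm_nonneg _), ← ENNReal.ofReal_mul (by positivity)]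
    congr 1
    rw [add_sub_cancel_left]; ring
  · simp only [Function.uncurry_def]
    fun_prop

theorem SchwartzMap.lintegral_enorm_sq_fourier (f : 𝓢(ℝ, ℂ)) :
    ∫⁻ ξ, ‖𝓕 f ξ‖ₑ ^ 2 = ∫⁻ x, ‖f x‖ₑ ^ 2 := by
  have key : ∀ g : 𝓢(ℝ, ℂ), ∫⁻ x, ‖g x‖ₑ ^ 2 = ENNReal.ofReal (∫ x, ‖g x‖ ^ 2) := by
    intro g
    have hi : Integrable (fun x => ‖g x‖ ^ 2) :=
      (g.memLp ((2 : ℕ) : ℝ≥0∞)).integrable_norm_pow two_ne_zero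
    rw [ofReal_integral_eq_lintegral_ofReal hi (Eventually.of_forall fun x => by positivity)]
    refine lintegral_congr fun x => ?_
    rw [← ofReal_norm, ← ENNReal.ofReal_pow (norm_nonneg _)]
  rw [key, key, SchwartzMap.integral_norm_sq_fourier]

/-- The finite difference `x ↦ f (x - a) - f x`. -/
def SchwartzMap.subShift (a : ℝ) (f : 𝓢(ℝ, ℂ)) : 𝓢(ℝ, ℂ) :=
  f.compSubConstCLM ℂ a - f

@[simp] theorem SchwartzMap.subShift_apply (a : ℝ) (f : 𝓢(ℝ, ℂ)) (x : ℝ) :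
    f.subShift a x = f (x - a) - f x := rfl

theorem SchwartzMap.fourier_subShift (a : ℝ) (f : 𝓢(ℝ, ℂ)) (ξ : ℝ) :
    𝓕 (f.subShift a) ξ = (Complex.exp (-(a * (2 * Real.pi * ξ) : ℝ) * Complex.I) - 1) * 𝓕 f ξ := by
  have h1 : 𝓕 (f.compSubConstCLM ℂ a) ξ
      = Complex.exp (-(a * (2 * Real.pi * ξ) : ℝ) * Complex.I) * 𝓕 f ξ := by
    simp only [SchwartzMap.fourier_coe]
    rw [Real.fourier_real_eq_integral_exp_smul, Real.fourier_real_eq_integral_exp_smul,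
      ← integral_const_mul, ← integral_add_right_eq_self _ a]
    refine integral_congr_ae (Eventually.of_forall fun x => ?_)
    simp only [SchwartzMap.compSubConstCLM_apply, add_sub_cancel_right, smul_eq_mul]
    rw [← mul_assoc, ← Complex.exp_add]
    congr 2
    push_cast; ring
  have h2 : 𝓕 (f.subShift a) = 𝓕 (f.compSubConstCLM ℂ a) - 𝓕 f :=
    map_sub (SchwartzMap.fourierTransformCLM ℂ) _ _
  rw [h2, sub_apply, h1]
  ring

theorem norm_exp_neg_mul_I_sub_one_sq (θ : ℝ) :
    ‖Complex.exp (-(θ : ℝ) * Complex.I) - 1‖ ^ 2 = 2 - 2 * Real.cos θ := by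
  rw [← Complex.normSq_eq_norm_sq, ← Complex.ofReal_neg, Complex.exp_mul_I, Complex.normSq_apply]
  simp [← Complex.ofReal_cos, ← Complex.ofReal_sin]
  nlinarith [Real.sin_sq_add_cos_sq θ]

theorem gagliardoSq_schwartz (f : 𝓢(ℝ, ℂ)) :
    gagliardoSq f = ∫⁻ ξ, ENNReal.ofReal (4 * Real.pi ^ 2 * |ξ|) * ‖𝓕 f ξ‖ₑ ^ 2 := by
  rw [gagliardoSq_eq_lintegral_diff f.continuous.measurable]
  have hm : Measurable (fun ξ => 𝓕 f ξ) := (𝓕 f).continuous.measurable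
  have h1 : ∀ h : ℝ, ∫⁻ x, ‖f (x + h) - f x‖ₑ ^ 2
      = ∫⁻ ξ, ENNReal.ofReal (2 - 2 * Real.cos (h * (2 * Real.pi * ξ))) * ‖𝓕 f ξ‖ₑ ^ 2 := by
    intro h
    have := SchwartzMap.lintegral_enorm_sq_fourier (f.subShift (-h))
    simp only [SchwartzMap.subShift_apply, sub_neg_eq_add] at this
    rw [← this]
    refine lintegral_congr fun ξ => ?_
    rw [SchwartzMap.fourier_subShift, enorm_mul, mul_pow, ← ofReal_norm (Complex.exp _ - 1),
      ← ENNReal.ofReal_pow (norm_nonneg _), norm_exp_neg_mul_I_sub_one_sq]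
    congr 4
    rw [neg_mul, Real.cos_neg]
  simp only [h1]
  have h2 : ∀ h : ℝ, ENNReal.ofReal (1 / h ^ 2) *
      ∫⁻ ξ, ENNReal.ofReal (2 - 2 * Real.cos (h * (2 * Real.pi * ξ))) * ‖𝓕 f ξ‖ₑ ^ 2
      = ∫⁻ ξ, ENNReal.ofReal ((2 - 2 * Real.cos (h * (2 * Real.pi * ξ))) / h ^ 2)
          * ‖𝓕 f ξ‖ₑ ^ 2 := by
    intro h
    rw [← lintegral_const_mul _ (by fun_prop)]
    refine lintegral_congr fun ξ => ?_
    rw [← mul_assoc, ← ENNReal.ofReal_mul (by positivity)]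
    congr 2; ring
  simp only [h2]
  rw [lintegral_lintegral_swap (by simp only [Function.uncurry_def]; fun_prop)]
  refine lintegral_congr fun ξ => ?_
  rw [lintegral_mul_const _ (by fun_prop), lintegral_two_sub_two_cos_div_sq]
  congr 2
  rw [abs_mul, abs_of_pos (by positivity : 0 < 2 * Real.pi)]
  ring

theorem exists_inner_eq_of_norm_le {V D : Type*} [AddCommGroup V] [Module ℂ V]
    [NormedAddCommGroup D] [InnerProductSpace ℂ D] [CompleteSpace D]
    (J : V →ₗ[ℂ] D) (l : V →ₗ[ℂ] ℂ) {C : ℝ} (hC : 0 ≤ C) (h : ∀ v, ‖l v‖ ≤ C * ‖J v‖) :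
    ∃ G : D, ‖G‖ ≤ C ∧ ∀ v, l v = inner ℂ G (J v) := by
  obtain ⟨g, hg⟩ := J.rangeRestrict.exists_rightInverse_of_surjective J.range_rangeRestrict
  have hg' : ∀ y, J (g y) = y := fun y =>
    congrArg Subtype.val (LinearMap.congr_fun hg y)
  let f : LinearMap.range J →L[ℂ] ℂ := (l ∘ₗ g).mkContinuous C fun y => by
    have := h (g y)
    rwa [hg'] at this
  obtain ⟨F, hF, hn⟩ := exists_extension_norm_eq _ f
  refine ⟨(InnerProductSpace.toDual ℂ D).symm F, ?_, fun v => ?_⟩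
  · rw [LinearIsometryEquiv.norm_map, hn]
    exact LinearMap.mkContinuous_norm_le _ hC _
  · rw [InnerProductSpace.toDual_symm_apply]
    have h1 := hF ⟨J v, v, rfl⟩
    rw [h1]
    change l v = l (g ⟨J v, v, rfl⟩)
    have h2 := h (v - g ⟨J v, v, rfl⟩)
    rw [map_sub, map_sub, hg', sub_self, norm_zero, mul_zero] at h2
    exact sub_eq_zero.1 (norm_le_zero_iff.1 h2)

theorem eLpNorm_two_sq {E : Type*} [NormedAddCommGroup E] (f : ℝ → E) :
    eLpNorm f 2 volume ^ 2 = ∫⁻ x, ‖f x‖ₑ ^ 2 := by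
  simpa using eLpNorm_nnreal_pow_eq_lintegral (μ := volume) (f := f) (p := 2) two_ne_zero

theorem SchwartzMap.fourier_derivCLM_apply (f : 𝓢(ℝ, ℂ)) (ξ : ℝ) :
    𝓕 (derivCLM ℂ ℂ f) ξ = 2 * Real.pi * Complex.I * ξ * 𝓕 f ξ := by
  have h : (derivCLM ℂ ℂ f : ℝ → ℂ) = deriv f := by ext; simp
  rw [SchwartzMap.fourier_coe, h,
    Real.fourier_deriv f.integrable f.differentiable (h ▸ (derivCLM ℂ ℂ f).integrable)]
  simp [SchwartzMap.fourier_coe]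

theorem SchwartzMap.memLp_sqrt_abs_mul_fourier (f : 𝓢(ℝ, ℂ)) :
    MemLp (fun ξ : ℝ => (Real.sqrt |ξ| : ℂ) * 𝓕 f ξ) 2 := by
  have hm : Continuous (fun ξ => 𝓕 f ξ) := (𝓕 f).continuous
  have hs : AEStronglyMeasurable (fun ξ : ℝ => (Real.sqrt |ξ| : ℂ) * 𝓕 f ξ) :=
    Continuous.aestronglyMeasurable (by fun_prop)
  refine (((𝓕 f).memLp 2).norm.add ((𝓕 (derivCLM ℂ ℂ f)).memLp 2).norm).mono' hs
    (Eventually.of_forall fun ξ => ?_)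
  simp only [Pi.add_apply, SchwartzMap.fourier_derivCLM_apply, norm_mul, Complex.norm_real,
    Complex.norm_I, Complex.norm_ofNat, Real.norm_eq_abs, mul_one]
  have h1 : Real.sqrt |ξ| ≤ 1 + |ξ| := by
    rw [Real.sqrt_le_left (by positivity)]
    nlinarith [abs_nonneg ξ]
  have h2 : |ξ| ≤ 2 * |Real.pi| * |ξ| := by
    rw [abs_of_pos Real.pi_pos]
    nlinarith [abs_nonneg ξ, Real.pi_gt_three]
  rw [abs_of_nonneg (Real.sqrt_nonneg _)]
  nlinarith [norm_nonneg (𝓕 f ξ)]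

/-- The map `f ↦ |ξ|^{1/2} 𝓕 f` from Schwartz functions to `L²`. -/
def SchwartzMap.halfFourier : 𝓢(ℝ, ℂ) →ₗ[ℂ] Lp ℂ 2 (volume : Measure ℝ) where
  toFun f := f.memLp_sqrt_abs_mul_fourier.toLp
  map_add' f g := by
    rw [← MemLp.toLp_add]
    refine MemLp.toLp_congr _ _ (Eventually.of_forall fun ξ => ?_)
    have h : 𝓕 (f + g) = 𝓕 f + 𝓕 g := map_add (SchwartzMap.fourierTransformCLM ℂ) _ _
    simp [h, mul_add]
  map_smul' c f := by
    rw [RingHom.id_apply, ← MemLp.toLp_const_smul]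
    refine MemLp.toLp_congr _ _ (Eventually.of_forall fun ξ => ?_)
    have h : 𝓕 (c • f) = c • 𝓕 f := map_smul (SchwartzMap.fourierTransformCLM ℂ) _ _
    simp [h, mul_left_comm]

theorem SchwartzMap.coeFn_halfFourier (f : 𝓢(ℝ, ℂ)) :
    SchwartzMap.halfFourier f =ᵐ[volume] fun ξ : ℝ => (Real.sqrt |ξ| : ℂ) * 𝓕 f ξ :=
  f.memLp_sqrt_abs_mul_fourier.coeFn_toLp

theorem gagliardoSq_eq_enorm_halfFourier (f : 𝓢(ℝ, ℂ)) :
    gagliardoSq f = (ENNReal.ofReal (2 * Real.pi) * ‖SchwartzMap.halfFourier f‖ₑ) ^ 2 := by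
  have h : ‖SchwartzMap.halfFourier f‖ₑ
      = eLpNorm (fun ξ : ℝ => (Real.sqrt |ξ| : ℂ) * 𝓕 f ξ) 2 volume :=
    Lp.enorm_toLp f.memLp_sqrt_abs_mul_fourier
  have hm : Measurable (fun ξ => 𝓕 f ξ) := (𝓕 f).continuous.measurable
  rw [mul_pow, h, eLpNorm_two_sq, gagliardoSq_schwartz, ← lintegral_const_mul _ (by fun_prop)]
  refine lintegral_congr fun ξ => ?_
  rw [enorm_mul, mul_pow, ← mul_assoc]
  congr 1
  rw [← ofReal_norm, Complex.norm_real, Real.norm_of_nonneg (Real.sqrt_nonneg _),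
    ← ENNReal.ofReal_pow (Real.sqrt_nonneg _), Real.sq_sqrt (abs_nonneg _),
    ← ENNReal.ofReal_pow (by positivity), ← ENNReal.ofReal_mul (by positivity)]
  congr 1; ring

theorem integrable_mul_deriv_schwartz {q : ℝ → ℝ} (hq : MemLp q ⊤) (f : 𝓢(ℝ, ℂ)) :
    Integrable fun x => (q x : ℂ) * deriv f x := by
  have h : Integrable (deriv f) := by
    have := (SchwartzMap.derivCLM ℂ ℂ f).integrable (μ := volume)
    exact this
  have hq' : MemLp (fun x => (q x : ℂ)) ⊤ := hq.ofReal
  exact (h.mul_of_top_right hq')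

theorem enorm_integral_mul_deriv_le {q : ℝ → ℝ} (hq : MemLp q ⊤) {B : ℝ≥0∞}
    (H : ∀ f : 𝓢(ℝ, ℝ), ‖∫ x, q x * deriv f x‖ₑ ^ 2 ≤ B * gagliardoSq f) (f : 𝓢(ℝ, ℂ)) :
    ‖∫ x, (q x : ℂ) * deriv f x‖ₑ ^ 2 ≤ B * gagliardoSq f := by
  set I := ∫ x, (q x : ℂ) * deriv f x with hI
  rcases eq_or_ne I 0 with h0 | h0
  · simp [h0]
  set c : ℂ := conj I / ‖I‖ with hc
  have hIn : (‖I‖ : ℂ) ≠ 0 := by simpa using h0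
  have hcn : ‖c‖ = 1 := by
    rw [hc, norm_div, RCLike.norm_conj, Complex.norm_real, norm_norm, div_self (by simpa using h0)]
  have hcI : c * I = ‖I‖ := by
    rw [hc, div_mul_eq_mul_div, Complex.conj_mul']
    field_simp
  set g : 𝓢(ℝ, ℝ) := (c • f).postcompCLM Complex.reCLM with hg
  have hga : ∀ x, g x = (c * f x).re := fun x => rfl
  have hgd : ∀ x, deriv g x = (c * deriv f x).re := by
    intro x
    have h1 : HasDerivAt (fun x => c * f x) (c * deriv f x) x :=
      (f.differentiable x).hasDerivAt.const_mul c
    exact (Complex.reCLM.hasFDerivAt.comp_hasDerivAt x h1).deriv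
  have hint : ∫ x, q x * deriv g x = ‖I‖ := by
    have h1 := integral_re ((integrable_mul_deriv_schwartz hq f).const_mul c)
    rw [integral_const_mul, ← hI, hcI] at h1
    simp only [RCLike.re_to_complex, Complex.ofReal_re] at h1
    rw [← h1]
    refine integral_congr_ae (Eventually.of_forall fun x => ?_)
    simp only [hgd]
    rw [mul_left_comm, Complex.re_ofReal_mul]
  have hle : gagliardoSq g ≤ gagliardoSq f := by
    refine lintegral_mono fun x => lintegral_mono fun y => ENNReal.ofReal_le_ofReal ?_
    gcongr
    rw [hga, hga, ← Complex.sub_re, ← mul_sub]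
    calc ‖(c * (f x - f y)).re‖ ≤ ‖c * (f x - f y)‖ := Complex.abs_re_le_norm _
      _ = ‖f x - f y‖ := by rw [norm_mul, hcn, one_mul]
  have := H g
  rw [hint, enorm_norm] at this
  exact this.trans (by gcongr)

theorem integral_diff_mul_deriv {q : ℝ → ℝ} (hq : MemLp q ⊤) (a : ℝ) (f : 𝓢(ℝ, ℂ)) :
    ∫ x, ((q (x + a) - q x : ℝ) : ℂ) * deriv f x
      = ∫ x, (q x : ℂ) * deriv (f.subShift a) x := by
  have hd : ∀ x, deriv (f.subShift a) x = deriv f (x - a) - deriv f x := by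
    intro x
    have h1 : HasDerivAt (fun x => f (x - a) - f x) (deriv f (x - a) - deriv f x) x :=
      ((f.differentiable (x - a)).hasDerivAt.comp_sub_const x a).sub
        (f.differentiable x).hasDerivAt
    exact h1.deriv
  have hi := integrable_mul_deriv_schwartz hq f
  have hi' : Integrable fun x => (q (x + a) : ℂ) * deriv f x := by
    have h := (integrable_mul_deriv_schwartz hq (f.compSubConstCLM ℂ a)).comp_add_right a
    refine h.congr (Eventually.of_forall fun x => ?_)
    have : deriv (f.compSubConstCLM ℂ a) (x + a) = deriv f x := by
      have h1 : HasDerivAt (fun x => f (x - a)) (deriv f (x + a - a)) (x + a) :=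
        (f.differentiable (x + a - a)).hasDerivAt.comp_sub_const (x + a) a
      rw [add_sub_cancel_right] at h1
      exact h1.deriv
    simp [this]
  have hi'' : Integrable fun x => (q x : ℂ) * deriv f (x - a) := by
    simpa using hi'.comp_sub_right a
  simp only [hd, Complex.ofReal_sub, sub_mul, mul_sub]
  have h := integral_sub_right_eq_self (μ := volume) (fun x => (q (x + a) : ℂ) * deriv f x) a
  simp only [sub_add_cancel] at h
  rw [integral_sub hi' hi, integral_sub hi'' hi, h]

theorem ae_fourier_diff_eq {q : ℝ → ℝ} (hq : MemLp q ⊤) {G : Lp ℂ 2 (volume : Measure ℝ)}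
    (hG : ∀ f : 𝓢(ℝ, ℂ), ∫ x, (q x : ℂ) * deriv f x = inner ℂ G (SchwartzMap.halfFourier f))
    (a : ℝ) (hg : MemLp (fun x => ((q (x + a) - q x : ℝ) : ℂ)) 2) :
    ∀ᵐ ξ : ℝ, conj ((𝓕 hg.toLp : Lp ℂ 2 (volume : Measure ℝ)) ξ) * (2 * Real.pi * Complex.I * ξ)
      = conj (G ξ) * (Real.sqrt |ξ| *
        (Complex.exp (-(a * (2 * Real.pi * ξ) : ℝ) * Complex.I) - 1)) := by
  set k : Lp ℂ 2 (volume : Measure ℝ) := 𝓕 hg.toLp with hk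
  have main : ∀ f : 𝓢(ℝ, ℂ),
      ∫ ξ, 𝓕 f ξ * (conj (k ξ) * (2 * Real.pi * Complex.I * ξ))
        = ∫ ξ, 𝓕 f ξ * (conj (G ξ) * (Real.sqrt |ξ| *
          (Complex.exp (-(a * (2 * Real.pi * ξ) : ℝ) * Complex.I) - 1))) := by
    intro f
    have h1 : inner ℂ hg.toLp ((SchwartzMap.derivCLM ℂ ℂ f).toLp 2 : Lp ℂ 2 (volume : Measure ℝ))
        = ∫ x, ((q (x + a) - q x : ℝ) : ℂ) * deriv f x := by
      rw [L2.inner_def]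
      refine integral_congr_ae ?_
      filter_upwards [hg.coeFn_toLp, (SchwartzMap.derivCLM ℂ ℂ f).coeFn_toLp 2] with x h2 h3
      rw [h2, h3, RCLike.inner_apply, Complex.conj_ofReal, SchwartzMap.derivCLM_apply, mul_comm]
    have h2 : inner ℂ hg.toLp ((SchwartzMap.derivCLM ℂ ℂ f).toLp 2 : Lp ℂ 2 (volume : Measure ℝ))
        = ∫ ξ, 𝓕 f ξ * (conj (k ξ) * (2 * Real.pi * Complex.I * ξ)) := by
      rw [← Lp.inner_fourier_eq, SchwartzMap.toLp_fourier_eq, L2.inner_def]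
      refine integral_congr_ae ?_
      filter_upwards [(𝓕 (SchwartzMap.derivCLM ℂ ℂ f)).coeFn_toLp 2] with ξ h3
      rw [h3, RCLike.inner_apply, SchwartzMap.fourier_derivCLM_apply]
      ring
    rw [← h2, h1, integral_diff_mul_deriv hq, hG, L2.inner_def]
    refine integral_congr_ae ?_
    filter_upwards [(f.subShift a).coeFn_halfFourier] with ξ h3
    rw [h3, RCLike.inner_apply, SchwartzMap.fourier_subShift]
    ring
  have hlk : LocallyIntegrable (fun ξ => conj (k ξ)) :=
    ((Lp.memLp k).star).locallyIntegrable one_le_two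
  have hlG : LocallyIntegrable (fun ξ => conj (G ξ)) :=
    ((Lp.memLp G).star).locallyIntegrable one_le_two
  refine ae_eq_of_integral_contDiff_smul_eq (hlk.mul_continuous (by fun_prop))
    (hlG.mul_continuous (by fun_prop)) fun η hη hη' => ?_
  have hηc : ContDiff ℝ ((⊤ : ℕ∞) : WithTop ℕ∞) (fun x => (η x : ℂ)) :=
    Complex.ofRealCLM.contDiff.comp hη
  have hηs : HasCompactSupport (fun x => (η x : ℂ)) :=
    hη'.comp_left (g := ((↑) : ℝ → ℂ)) Complex.ofReal_zero
  have := main (𝓕⁻ (hηs.toSchwartzMap hηc))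
  rw [FourierTransform.fourier_fourierInv_eq] at this
  simpa only [HasCompactSupport.toSchwartzMap_toFun, Complex.real_smul] using this

theorem lintegral_enorm_diff_sq_eq {q : ℝ → ℝ} (hq : MemLp q ⊤)
    {G : Lp ℂ 2 (volume : Measure ℝ)}
    (hG : ∀ f : 𝓢(ℝ, ℂ), ∫ x, (q x : ℂ) * deriv f x = inner ℂ G (SchwartzMap.halfFourier f))
    (a : ℝ) (hg : MemLp (fun x => ((q (x + a) - q x : ℝ) : ℂ)) 2) :
    ∫⁻ x, ‖q (x + a) - q x‖ₑ ^ 2 = ∫⁻ ξ, ENNReal.ofReal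
      ((2 - 2 * Real.cos (a * (2 * Real.pi * ξ))) / (4 * Real.pi ^ 2 * |ξ|)) * ‖G ξ‖ₑ ^ 2 := by
  have h1 : ∫⁻ x, ‖q (x + a) - q x‖ₑ ^ 2
      = ∫⁻ ξ, ‖(𝓕 hg.toLp : Lp ℂ 2 (volume : Measure ℝ)) ξ‖ₑ ^ 2 := by
    rw [← eLpNorm_two_sq, ← eLpNorm_two_sq, ← Lp.enorm_def]
    have : ‖(𝓕 hg.toLp : Lp ℂ 2 (volume : Measure ℝ))‖ₑ = ‖hg.toLp‖ₑ := by
      rw [← ofReal_norm, Lp.norm_fourier_eq, ofReal_norm]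
    rw [this, Lp.enorm_toLp]
    congr 1
    refine eLpNorm_congr_norm_ae (Eventually.of_forall fun x => ?_)
    rw [Complex.norm_real]
  rw [h1]
  refine lintegral_congr_ae ?_
  have hne : ∀ᵐ ξ : ℝ, ξ ≠ 0 := by simp [ae_iff]
  filter_upwards [ae_fourier_diff_eq hq hG a hg, hne] with ξ h2 h3
  set k := (𝓕 hg.toLp : Lp ℂ 2 (volume : Measure ℝ)) ξ
  have h4 := congrArg (fun z : ℂ => ‖z‖ ^ 2) h2
  simp only [norm_mul, mul_pow, norm_exp_neg_mul_I_sub_one_sq, RCLike.norm_conj, Complex.norm_real,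
    Complex.norm_I, Complex.norm_ofNat, Real.norm_eq_abs, sq_abs, mul_one,
    Real.sq_sqrt (abs_nonneg ξ)] at h4
  rw [← ofReal_norm, ← ofReal_norm, ← ENNReal.ofReal_pow (norm_nonneg _),
    ← ENNReal.ofReal_pow (norm_nonneg _), ← ENNReal.ofReal_mul]
  · congr 1
    have hξ : 0 < |ξ| := abs_pos.2 h3
    rw [← sq_abs ξ] at h4
    generalize Real.cos (a * (2 * Real.pi * ξ)) = c at h4 ⊢
    rw [div_mul_eq_mul_div, eq_div_iff (by positivity)]
    refine mul_left_cancel₀ hξ.ne' ?_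
    linear_combination h4
  · have := Real.cos_le_one (a * (2 * Real.pi * ξ))
    exact div_nonneg (by linarith) (by positivity)

/-- If the distributional derivative of a bounded function of finite Gagliardo energy has dual
norm at most `b`, measured against the Gagliardo seminorm, then its Gagliardo seminorm is at most
`2 π b`. -/
theorem gagliardoSq_le_of_dual_bound {q : ℝ → ℝ} (hqm : Measurable q) (hq : MemLp q ⊤)
    (hE : gagliardoSq q ≠ ⊤) {B : ℝ≥0∞} (hB : B ≠ ⊤)
    (H : ∀ f : 𝓢(ℝ, ℝ), ‖∫ x, q x * deriv f x‖ₑ ^ 2 ≤ B * gagliardoSq f) :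
    gagliardoSq q ≤ ENNReal.ofReal (2 * Real.pi) ^ 2 * B := by
  set K : ℝ≥0∞ := ENNReal.ofReal (2 * Real.pi) ^ 2 * B with hK
  have hKt : K ≠ ⊤ := ENNReal.mul_ne_top (by finiteness) hB
  let l : 𝓢(ℝ, ℂ) →ₗ[ℂ] ℂ :=
    { toFun := fun f => ∫ x, (q x : ℂ) * deriv f x
      map_add' := fun f g => by
        have hd : ∀ x, deriv (f + g : 𝓢(ℝ, ℂ)) x = deriv f x + deriv g x := fun x =>
          ((f.differentiable x).hasDerivAt.add (g.differentiable x).hasDerivAt).deriv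
        simp only [hd, mul_add]
        exact integral_add (integrable_mul_deriv_schwartz hq f)
          (integrable_mul_deriv_schwartz hq g)
      map_smul' := fun c f => by
        have hd : ∀ x, deriv (c • f : 𝓢(ℝ, ℂ)) x = c * deriv f x := fun x =>
          ((f.differentiable x).hasDerivAt.const_mul c).deriv
        simp only [hd, mul_left_comm _ c]
        rw [integral_const_mul, RingHom.id_apply, smul_eq_mul] }
  have hl : ∀ f, ‖l f‖ ≤ Real.sqrt K.toReal * ‖SchwartzMap.halfFourier f‖ := by
    intro f
    have h1 := enorm_integral_mul_deriv_le hq H f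
    rw [gagliardoSq_eq_enorm_halfFourier, mul_pow, ← mul_assoc, mul_comm B, ← hK] at h1
    have h2 := ENNReal.toReal_mono (ENNReal.mul_ne_top hKt (by finiteness)) h1
    rw [ENNReal.toReal_mul, ENNReal.toReal_pow, ENNReal.toReal_pow, toReal_enorm, toReal_enorm] at h2
    refine le_of_sq_le_sq ?_ (by positivity)
    rwa [mul_pow, Real.sq_sqrt ENNReal.toReal_nonneg]
  obtain ⟨G, hGn, hG⟩ := exists_inner_eq_of_norm_le SchwartzMap.halfFourier l
    (Real.sqrt_nonneg _) hl
  have hGK : ∫⁻ ξ, ‖G ξ‖ₑ ^ 2 ≤ K := by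
    rw [← eLpNorm_two_sq, ← Lp.enorm_def, ← ofReal_norm, ← ENNReal.ofReal_pow (norm_nonneg _)]
    refine ENNReal.ofReal_le_of_le_toReal ?_
    calc ‖G‖ ^ 2 ≤ Real.sqrt K.toReal ^ 2 := by gcongr
      _ = K.toReal := Real.sq_sqrt ENNReal.toReal_nonneg
  have hGm : AEMeasurable (fun ξ => ‖G ξ‖ₑ ^ 2) :=
    ((Lp.aestronglyMeasurable G).enorm).pow_const 2
  rw [gagliardoSq_eq_lintegral_diff hqm] at hE ⊢
  have hm : Measurable fun h : ℝ =>
      ENNReal.ofReal (1 / h ^ 2) * ∫⁻ x, ‖q (x + h) - q x‖ₑ ^ 2 := by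
    refine Measurable.mul (by fun_prop) (Measurable.lintegral_prod_right' (f := fun p : ℝ × ℝ =>
      ‖q (p.2 + p.1) - q p.2‖ₑ ^ 2) (by fun_prop))
  have hne : ∀ᵐ h : ℝ, h ≠ 0 := by simp [ae_iff]
  have hae : ∀ᵐ h : ℝ, ENNReal.ofReal (1 / h ^ 2) * ∫⁻ x, ‖q (x + h) - q x‖ₑ ^ 2
      = ∫⁻ ξ, ENNReal.ofReal ((2 - 2 * Real.cos (h * (2 * Real.pi * ξ))) / h ^ 2)
        * (ENNReal.ofReal (1 / (4 * Real.pi ^ 2 * |ξ|)) * ‖G ξ‖ₑ ^ 2) := by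
    filter_upwards [ae_lt_top hm hE, hne] with h h1 h2
    have hpos : 0 < ENNReal.ofReal (1 / h ^ 2) := ENNReal.ofReal_pos.2 (by positivity)
    have h3 : ∫⁻ x, ‖q (x + h) - q x‖ₑ ^ 2 ≠ ⊤ := by
      intro htop
      rw [htop, ENNReal.mul_top hpos.ne'] at h1
      exact lt_irrefl _ h1
    have hg : MemLp (fun x => ((q (x + h) - q x : ℝ) : ℂ)) 2 := by
      refine ⟨(by fun_prop : Measurable fun x => ((q (x + h) - q x : ℝ) : ℂ)).aestronglyMeasurable,
        ?_⟩
      have h4 : eLpNorm (fun x => ((q (x + h) - q x : ℝ) : ℂ)) 2 volume ^ 2 ≠ ⊤ := by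
        rw [eLpNorm_two_sq]
        convert h3 using 4 with x
        rw [← ofReal_norm, Complex.norm_real, ofReal_norm]
      exact lt_top_iff_ne_top.2 fun h5 => h4 (by rw [h5]; simp)
    rw [lintegral_enorm_diff_sq_eq hq hG h hg, ← lintegral_const_mul' _ _ ENNReal.ofReal_ne_top]
    refine lintegral_congr fun ξ => ?_
    have hcos := Real.cos_le_one (h * (2 * Real.pi * ξ))
    generalize Real.cos (h * (2 * Real.pi * ξ)) = c at hcos ⊢
    rw [← mul_assoc, ← mul_assoc, ← ENNReal.ofReal_mul (by positivity), ← ENNReal.ofReal_mul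
      (div_nonneg (sub_nonneg.2 (by linarith)) (sq_nonneg h))]
    congr 2; ring
  rw [lintegral_congr_ae hae, lintegral_lintegral_swap]
  · refine le_trans (lintegral_mono_ae ?_) hGK
    filter_upwards [hne] with ξ hξ
    rw [lintegral_mul_const _ (by fun_prop), lintegral_two_sub_two_cos_div_sq, ← mul_assoc,
      ← ENNReal.ofReal_mul (by positivity)]
    have hξ' : 0 < |ξ| := abs_pos.2 hξ
    have : 2 * Real.pi * |2 * Real.pi * ξ| * (1 / (4 * Real.pi ^ 2 * |ξ|)) = 1 := by
      rw [abs_mul, abs_of_pos (by positivity : 0 < 2 * Real.pi)]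
      field_simp
      norm_num
    rw [this, ENNReal.ofReal_one, one_mul]
  · have hm1 : Measurable fun p : ℝ × ℝ =>
        ENNReal.ofReal ((2 - 2 * Real.cos (p.1 * (2 * Real.pi * p.2))) / p.1 ^ 2) := by fun_prop
    have hm2 : Measurable fun p : ℝ × ℝ => ENNReal.ofReal (1 / (4 * Real.pi ^ 2 * |p.2|)) := by
      fun_prop
    exact hm1.aemeasurable.mul (hm2.aemeasurable.mul hGm.comp_snd)

/-- The Cauchy–Schwarz inequality for the Gagliardo pairing. -/
theorem enorm_integral_integral_mul_div_sq_le {g h : ℝ → ℝ → ℝ}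
    (hg : Measurable (Function.uncurry g)) (hh : Measurable (Function.uncurry h)) :
    ‖∫ x, ∫ y, g x y * h x y / (x - y) ^ 2‖ₑ ^ 2
      ≤ (∫⁻ x, ∫⁻ y, ENNReal.ofReal (g x y ^ 2 / (x - y) ^ 2))
        * ∫⁻ x, ∫⁻ y, ENNReal.ofReal (h x y ^ 2 / (x - y) ^ 2) := by
  have key : ∀ k : ℝ → ℝ → ℝ, Measurable (Function.uncurry k) →
      ∫⁻ x, ∫⁻ y, ENNReal.ofReal (k x y ^ 2 / (x - y) ^ 2)
        = ∫⁻ z : ℝ × ℝ, ‖k z.1 z.2 / (z.1 - z.2)‖ₑ ^ (2 : ℝ) := by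
    intro k hk
    have hk' : Measurable fun z : ℝ × ℝ => k z.1 z.2 := hk
    rw [lintegral_lintegral (Measurable.aemeasurable (by fun_prop)), Measure.volume_eq_prod]
    refine lintegral_congr fun z => ?_
    rw [ENNReal.rpow_two, ← ofReal_norm, ← ENNReal.ofReal_pow (norm_nonneg _), Real.norm_eq_abs,
      sq_abs, div_pow]
  have hg' : Measurable fun z : ℝ × ℝ => g z.1 z.2 := hg
  have hh' : Measurable fun z : ℝ × ℝ => h z.1 z.2 := hh
  have h1 : ‖∫ x, ∫ y, g x y * h x y / (x - y) ^ 2‖ₑ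
      ≤ ∫⁻ z : ℝ × ℝ, ‖g z.1 z.2 / (z.1 - z.2)‖ₑ * ‖h z.1 z.2 / (z.1 - z.2)‖ₑ := by
    calc _ ≤ ∫⁻ x, ∫⁻ y, ‖g x y / (x - y)‖ₑ * ‖h x y / (x - y)‖ₑ := by
          refine (enorm_integral_le_lintegral_enorm _).trans (lintegral_mono fun x => ?_)
          refine (enorm_integral_le_lintegral_enorm _).trans (lintegral_mono fun y => ?_)
          rw [← enorm_mul, div_mul_div_comm, ← sq]
      _ = _ := by
          rw [lintegral_lintegral (Measurable.aemeasurable (by fun_prop)), Measure.volume_eq_prod]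
  have h2 := h1.trans (ENNReal.lintegral_mul_le_Lp_mul_Lq volume Real.HolderConjugate.two_two
    (f := fun z : ℝ × ℝ => ‖g z.1 z.2 / (z.1 - z.2)‖ₑ)
    (g := fun z : ℝ × ℝ => ‖h z.1 z.2 / (z.1 - z.2)‖ₑ)
    (Measurable.aemeasurable (by fun_prop)) (Measurable.aemeasurable (by fun_prop)))
  rw [← key g hg, ← key h hh, ← ENNReal.mul_rpow_of_nonneg _ _ (by norm_num)] at h2
  calc _ ≤ _ := pow_le_pow_left' h2 2
    _ = _ := by
      rw [← ENNReal.rpow_two, ← ENNReal.rpow_mul]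
      norm_num

theorem dot3_sub_cross3_single_sub (i : Fin 3) (p q : ℝ) (X Y : V3) :
    dot3 (X - Y) (cross3 (Pi.single i p) X - cross3 (Pi.single i q) Y)
      = (p - q) * cross3 Y X i := by
  fin_cases i <;> simp [dot3, cross3, cross_apply, Fin.sum_univ_three] <;> ring

theorem dot3_single (i : Fin 3) (p : ℝ) (X : V3) : dot3 X (Pi.single i p) = X i * p := by
  simp [dot3, Pi.single_apply]

theorem sum_cross3_sq {X Y : V3} (hX : ∑ i, X i ^ 2 = 1) (hY : ∑ i, Y i ^ 2 = 1) :
    ∑ i, cross3 Y X i ^ 2 = (∑ i, (X i - Y i) ^ 2) - (∑ i, (X i - Y i) ^ 2) ^ 2 / 4 := by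
  have h : ∑ i, (X i - Y i) ^ 2 = 2 - 2 * dot3 X Y := by
    simp only [dot3, Fin.sum_univ_three] at *
    linear_combination hX + hY
  rw [h]
  simp only [dot3, Fin.sum_univ_three, cross3, cross_apply, Matrix.cons_val] at *
  linear_combination (Y 0 ^ 2 + Y 1 ^ 2 + Y 2 ^ 2) * hX + hY

theorem measurable_cross3_apply {Q : ℝ → V3} (hmeas : Measurable Q) (i : Fin 3) :
    Measurable (Function.uncurry fun x y => cross3 (Q y) (Q x) i) := by
  have hQ : ∀ j, Measurable fun x => Q x j := fun j => (measurable_pi_apply j).comp hmeas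
  have := hQ 0
  have := hQ 1
  have := hQ 2
  fin_cases i <;> simp only [cross3, cross_apply, Function.uncurry_def, Fin.zero_eta,
    Fin.mk_one, Fin.reduceFinMk, Matrix.cons_val] <;> fun_prop

theorem WeakTravelingWave.enorm_integral_mul_deriv_le {v : ℝ} {Q : ℝ → V3}
    (heq : WeakTravelingWave v Q) (hmeas : Measurable Q) (i : Fin 3) (f : 𝓢(ℝ, ℝ)) :
    ‖∫ x, v * Q x i * deriv f x‖ₑ ^ 2
      ≤ ENNReal.ofReal (1 / (2 * Real.pi)) ^ 2
        * (∫⁻ x, ∫⁻ y, ENNReal.ofReal (cross3 (Q y) (Q x) i ^ 2 / (x - y) ^ 2))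
        * gagliardoSq f := by
  have hw := measurable_cross3_apply hmeas i
  have h := heq (SchwartzMap.postcompCLM (𝕜 := ℝ) (ContinuousLinearMap.single ℝ (fun _ => ℝ) i) f)
  have hd : ∀ x, deriv (fun t => SchwartzMap.postcompCLM (𝕜 := ℝ)
      (ContinuousLinearMap.single ℝ (fun _ : Fin 3 => ℝ) i) f t) x = Pi.single i (deriv f x) :=
    fun x => ((ContinuousLinearMap.single ℝ (fun _ : Fin 3 => ℝ) i).hasFDerivAt.comp_hasDerivAt x
      (f.differentiable x).hasDerivAt).deriv
  simp only [hd, dot3_single] at h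
  simp only [SchwartzMap.postcompCLM_apply, ContinuousLinearMap.single_apply,
    dot3_sub_cross3_single_sub] at h
  simp only [mul_assoc v]
  rw [integral_const_mul, ← h, enorm_mul, mul_pow, Real.enorm_of_nonneg (by positivity), mul_assoc]
  gcongr
  refine (enorm_integral_integral_mul_div_sq_le (by fun_prop) hw).trans_eq ?_
  simp only [mul_comm, gagliardoSq, Real.norm_eq_abs, sq_abs]

theorem gagliardoSq_const_mul (v : ℝ) {q : ℝ → ℝ} :
    gagliardoSq (fun x => v * q x) = ENNReal.ofReal (v ^ 2) * gagliardoSq q := by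
  simp only [gagliardoSq, ← lintegral_const_mul' _ _ ENNReal.ofReal_ne_top,
    ← ENNReal.ofReal_mul (sq_nonneg v), ← mul_sub, norm_mul, mul_pow, Real.norm_eq_abs, sq_abs,
    mul_div_assoc]

theorem lintegral_lintegral_sum_div {F : Fin 3 → ℝ → ℝ → ℝ}
    (hF : ∀ i, Measurable (Function.uncurry (F i))) :
    ∫⁻ x, ∫⁻ y, ENNReal.ofReal ((∑ i, F i x y ^ 2) / (x - y) ^ 2)
      = ∑ i, ∫⁻ x, ∫⁻ y, ENNReal.ofReal (F i x y ^ 2 / (x - y) ^ 2) := by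
  have hF' : ∀ i, Measurable fun z : ℝ × ℝ => F i z.1 z.2 := hF
  have hm : ∀ i, Measurable fun z : ℝ × ℝ => ENNReal.ofReal (F i z.1 z.2 ^ 2 / (z.1 - z.2) ^ 2) :=
    fun i => by have := hF' i; fun_prop
  have h1 : ∀ x y, ENNReal.ofReal ((∑ i, F i x y ^ 2) / (x - y) ^ 2)
      = ∑ i, ENNReal.ofReal (F i x y ^ 2 / (x - y) ^ 2) := fun x y => by
    rw [Finset.sum_div, ENNReal.ofReal_sum_of_nonneg fun i _ => by positivity]
  simp only [h1]
  rw [← lintegral_finsetSum _ fun i _ => (hm i).lintegral_prod_right']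
  refine lintegral_congr fun x => ?_
  exact lintegral_finsetSum _ fun i _ => (hm i).comp measurable_prodMk_left

end

/-- **Triviality of superluminal traveling solitary waves**: if `|v| ≥ 1`, any
finite-energy solution `Q_v ∈ Ḣ^{1/2}(ℝ; 𝕊²)` of `Q_v × |∇|Q_v + v ∂ₓQ_v = 0`
is a constant map `Q_v ≡ P` for some point `P ∈ 𝕊²`. -/
theorem traveling_wave_trivial_superluminal
    (v : ℝ) (hv : 1 ≤ |v|) (Q : ℝ → V3)
    (hmeas : Measurable Q)
    (hsphere : ∀ᵐ x : ℝ, ∑ i, (Q x i) ^ 2 = 1)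
    (henergy :
      (∫⁻ x : ℝ, ∫⁻ y : ℝ,
        ENNReal.ofReal ((∑ i, (Q x i - Q y i) ^ 2) / (x - y) ^ 2)) < ⊤)
    (heq : WeakTravelingWave v Q) :
    ∃ P : V3, (∑ i, (P i) ^ 2 = 1) ∧ ∀ᵐ x : ℝ, Q x = P := by
  have hQ : ∀ j, Measurable fun x => Q x j := fun j => (measurable_pi_apply j).comp hmeas
  have hQs : ∀ j, Measurable (Function.uncurry fun x y => Q x j - Q y j) := fun j =>
    ((hQ j).comp measurable_fst).sub ((hQ j).comp measurable_snd)
  have hw := measurable_cross3_apply hmeas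
  have hE : ∑ i, gagliardoSq (fun x => Q x i) = ∫⁻ x, ∫⁻ y,
      ENNReal.ofReal ((∑ i, (Q x i - Q y i) ^ 2) / (x - y) ^ 2) := by
    rw [lintegral_lintegral_sum_div hQs]
    simp only [gagliardoSq, Real.norm_eq_abs, sq_abs]
  have hs_meas : Measurable fun z : ℝ × ℝ => ∑ i, (Q z.1 i - Q z.2 i) ^ 2 :=
    Finset.measurable_sum _ fun i _ => (hQs i).pow_const 2
  set A : Fin 3 → ℝ≥0∞ := fun i =>
    ∫⁻ x, ∫⁻ y, ENNReal.ofReal (cross3 (Q y) (Q x) i ^ 2 / (x - y) ^ 2) with hA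
  set S : ℝ≥0∞ := ∫⁻ x, ∫⁻ y,
    ENNReal.ofReal ((∑ i, (Q x i - Q y i) ^ 2) ^ 2 / 4 / (x - y) ^ 2) with hS
  -- the unit-length constraint splits the energy
  have hsplit : ∑ i, A i + S = ∑ i, gagliardoSq (fun x => Q x i) := by
    rw [hE, hA, ← lintegral_lintegral_sum_div hw, hS, ← lintegral_add_right]
    · refine lintegral_congr_ae ?_
      filter_upwards [hsphere] with x hx
      rw [← lintegral_add_right]
      · refine lintegral_congr_ae ?_
        filter_upwards [hsphere] with y hy
        rw [← ENNReal.ofReal_add (by positivity) (by positivity), sum_cross3_sq hx hy, ← add_div,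
          sub_add_cancel]
      · have : Measurable fun y => ∑ i, (Q x i - Q y i) ^ 2 := hs_meas.comp measurable_prodMk_left
        fun_prop
    · exact Measurable.lintegral_prod_right' (f := fun z : ℝ × ℝ =>
        ENNReal.ofReal ((∑ i, (Q z.1 i - Q z.2 i) ^ 2) ^ 2 / 4 / (z.1 - z.2) ^ 2)) (by fun_prop)
  have hEt : ∑ i, gagliardoSq (fun x => Q x i) ≠ ⊤ := hE ▸ henergy.ne
  have hAt : ∑ i, A i ≠ ⊤ := ne_top_of_le_ne_top hEt (hsplit ▸ le_self_add)
  have hle : ∑ i, gagliardoSq (fun x => Q x i) ≤ ∑ i, A i := by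
    refine Finset.sum_le_sum fun i _ => ?_
    have hb : MemLp (fun x => v * Q x i) ⊤ := by
      refine MemLp.const_mul (memLp_top_of_bound (hQ i).aestronglyMeasurable 1 ?_) v
      filter_upwards [hsphere] with x hx
      rw [Real.norm_eq_abs, ← sq_le_one_iff_abs_le_one, ← hx]
      exact Finset.single_le_sum (f := fun i => Q x i ^ 2) (fun j _ => sq_nonneg _)
        (Finset.mem_univ i)
    have hAi : A i ≠ ⊤ := (ENNReal.sum_ne_top.1 hAt) i (Finset.mem_univ i)
    have hgi : gagliardoSq (fun x => Q x i) ≠ ⊤ := (ENNReal.sum_ne_top.1 hEt) i (Finset.mem_univ i)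
    have h := gagliardoSq_le_of_dual_bound ((hQ i).const_mul v) hb
      (by rw [gagliardoSq_const_mul]; finiteness)
      (ENNReal.mul_ne_top (by finiteness) hAi)
      (heq.enorm_integral_mul_deriv_le hmeas i)
    rw [gagliardoSq_const_mul, ← mul_assoc, ← mul_pow, ← ENNReal.ofReal_mul (by positivity),
      mul_one_div_cancel (by positivity), ENNReal.ofReal_one, one_pow, one_mul] at h
    refine le_trans ?_ h
    refine le_mul_of_one_le_left' ?_
    rw [← ENNReal.ofReal_one]
    exact ENNReal.ofReal_le_ofReal ((one_le_sq_iff_one_le_abs v).2 hv)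
  have hS0 : S = 0 := by
    rw [← hsplit] at hle
    exact nonpos_iff_eq_zero.1 <|
      (ENNReal.add_le_add_iff_left hAt).1 (hle.trans_eq (add_zero _).symm)
  rw [hS, lintegral_eq_zero_iff (Measurable.lintegral_prod_right' (f := fun z : ℝ × ℝ =>
    ENNReal.ofReal ((∑ i, (Q z.1 i - Q z.2 i) ^ 2) ^ 2 / 4 / (z.1 - z.2) ^ 2)) (by fun_prop))]
    at hS0
  obtain ⟨x, hx, hx1⟩ := (hS0.and hsphere).exists
  refine ⟨Q x, hx1, ?_⟩
  have hmx : Measurable fun y => ∑ i, (Q x i - Q y i) ^ 2 := hs_meas.comp measurable_prodMk_left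
  have h0 := (lintegral_eq_zero_iff (by fun_prop)).1 hx
  have hne : ∀ᵐ y : ℝ, y ≠ x := by simp [ae_iff]
  filter_upwards [h0, hne] with y hy hyx
  have h1 : 0 < (x - y) ^ 2 := by
    have := sub_ne_zero.2 hyx.symm
    positivity
  have h2 : (∑ i, (Q x i - Q y i) ^ 2) ^ 2 / 4 ≤ 0 := by
    have := ENNReal.ofReal_eq_zero.1 hy
    by_contra! hc
    exact absurd (div_pos hc h1) this.not_gt
  have h3 : ∑ i, (Q x i - Q y i) ^ 2 = 0 := by
    refine pow_eq_zero_iff two_ne_zero |>.1 (le_antisymm ?_ (sq_nonneg _))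
    linarith
  funext i
  have := (Finset.sum_eq_zero_iff_of_nonneg fun j _ => sq_nonneg _).1 h3 i (Finset.mem_univ i)
  exact (sub_eq_zero.1 (pow_eq_zero_iff two_ne_zero |>.1 this)).symm
end
end

section
/- Cotlar's identity: let H denote the Hilbert transform on ℝ, defined as the Fourier multiplier with symbol −i sgn(ξ). Then for all Schwartz functions f, g : ℝ → ℂ one has H(fg) = (Hf)g + f(Hg) + H((Hf)(Hg)). -/
/-!
Cotlar's identity for the Hilbert transform:
`H(fg) = (Hf)g + f(Hg) + H((Hf)(Hg))` for Schwartz functions `f, g`.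
-/

open MeasureTheory Filter
open scoped Topology

noncomputable section

/-- `HasHilbert f h` means that `h = Hf` pointwise, where `H` is the Hilbert
transform on ℝ (the Fourier multiplier with symbol `−i sgn ξ`), realized as the
principal-value singular integral `Hf(x) = (1/π) p.v. ∫ f(y)/(x-y) dy`. -/
def HasHilbert {E : Type*} [NormedAddCommGroup E] [NormedSpace ℝ E]
    (f h : ℝ → E) : Prop :=
  ∀ x : ℝ, Filter.Tendsto
    (fun ε : ℝ =>
      (Real.pi)⁻¹ • ∫ y in {y : ℝ | ε ≤ |x - y|}, (x - y)⁻¹ • f y)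
    (nhdsWithin 0 (Set.Ioi 0)) (nhds (h x))

theorem integral_exp_neg_mul_sin (R s : ℝ) :
    ∫ t in (0 : ℝ)..R, Real.exp (-(t * s)) * Real.sin t =
      (1 - Real.exp (-(R * s)) * (Real.cos R + s * Real.sin R)) * (1 + s ^ 2)⁻¹ := by
  have hs : (1 + s ^ 2) ≠ 0 := by positivity
  have hderiv (t : ℝ) : HasDerivAt
      (fun t => -(Real.exp (-(t * s)) * (Real.cos t + s * Real.sin t)) * (1 + s ^ 2)⁻¹)
      (Real.exp (-(t * s)) * Real.sin t) t := by
    have h1 := (((hasDerivAt_id t).mul_const s).neg.exp.mul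
      ((Real.hasDerivAt_cos t).add ((Real.hasDerivAt_sin t).const_mul s))).neg.mul_const
      (1 + s ^ 2)⁻¹
    refine h1.congr_deriv ?_
    simp only [id, Pi.neg_apply, Pi.add_apply]
    field_simp
    ring
  rw [intervalIntegral.integral_eq_sub_of_hasDerivAt (fun t _ => hderiv t)
    (by apply Continuous.intervalIntegrable; fun_prop)]
  simp
  ring

theorem integral_sinc_eq_integral_Ioi {R : ℝ} (hR : 0 ≤ R) :
    ∫ t in (0 : ℝ)..R, Real.sinc t = ∫ s in Set.Ioi (0 : ℝ),
      (1 - Real.exp (-(R * s)) * (Real.cos R + s * Real.sin R)) * (1 + s ^ 2)⁻¹ := by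
  have hlap {t : ℝ} (ht : 0 < t) :
      IntegrableOn (fun s => Real.exp (-(t * s))) (Set.Ioi 0) ∧
      ∫ s in Set.Ioi (0 : ℝ), Real.exp (-(t * s)) = t⁻¹ := by
    have h1 := integrableOn_exp_mul_Ioi (neg_lt_zero.2 ht) 0
    have h2 := integral_exp_mul_Ioi (neg_lt_zero.2 ht) 0
    simp only [neg_mul] at h1 h2
    exact ⟨h1, by rw [h2]; simp⟩
  have hint : Integrable (Function.uncurry fun t s : ℝ => Real.exp (-(t * s)) * Real.sin t)
      ((volume.restrict (Set.uIoc 0 R)).prod (volume.restrict (Set.Ioi 0))) := by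
    rw [integrable_prod_iff (by apply Continuous.aestronglyMeasurable; fun_prop)]
    rw [Set.uIoc_of_le hR]
    constructor
    · filter_upwards [ae_restrict_mem measurableSet_Ioc] with t ht
      exact Integrable.mul_const (hlap ht.1).1 (Real.sin t)
    · have : IntegrableOn (fun t => |Real.sinc t|) (Set.Ioc 0 R) :=
        (Real.continuous_sinc.abs.integrableOn_Icc).mono_set Set.Ioc_subset_Icc_self
      refine this.congr ?_
      filter_upwards [ae_restrict_mem measurableSet_Ioc] with t ht
      simp only [Function.uncurry, norm_mul, Real.norm_eq_abs, Real.abs_exp]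
      rw [integral_mul_const, (hlap ht.1).2, Real.sinc_of_ne_zero ht.1.ne', abs_div,
        abs_of_pos ht.1]
      ring
  have hswap := intervalIntegral_integral_swap hint
  simp only [integral_exp_neg_mul_sin] at hswap
  rw [← hswap]
  refine intervalIntegral.integral_congr_ae (ae_of_all _ fun t ht => ?_)
  rw [Set.uIoc_of_le hR] at ht
  rw [integral_mul_const, (hlap ht.1).2, Real.sinc_of_ne_zero ht.1.ne']
  ring

/-- The Dirichlet integral. -/
theorem tendsto_integral_sinc_atTop :
    Tendsto (fun R => ∫ t in (0 : ℝ)..R, Real.sinc t) atTop (𝓝 (Real.pi / 2)) := by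
  have hlim : Tendsto (fun R => ∫ s in Set.Ioi (0 : ℝ),
      (1 - Real.exp (-(R * s)) * (Real.cos R + s * Real.sin R)) * (1 + s ^ 2)⁻¹) atTop
      (𝓝 (∫ s in Set.Ioi (0 : ℝ), (1 + s ^ 2)⁻¹)) := by
    have hexp : IntegrableOn (fun s : ℝ => Real.exp (-s)) (Set.Ioi 0) := by
      simpa using integrableOn_exp_mul_Ioi (neg_lt_zero.2 one_pos) 0
    refine tendsto_integral_filter_of_dominated_convergence
      (fun s => (1 + s ^ 2)⁻¹ + 2 * Real.exp (-s)) ?_ ?_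
      (integrable_inv_one_add_sq.integrableOn.add (hexp.const_mul 2)) ?_
    · exact Eventually.of_forall fun R => by
        apply Measurable.aestronglyMeasurable; fun_prop
    · filter_upwards [eventually_ge_atTop 1] with R hR
      filter_upwards [ae_restrict_mem measurableSet_Ioi] with s (hs : 0 < s)
      have h1 : |Real.cos R + s * Real.sin R| ≤ 1 + s := by
        refine (abs_add_le _ _).trans (add_le_add (Real.abs_cos_le_one R) ?_)
        rw [abs_mul, abs_of_pos hs]
        exact mul_le_of_le_one_right hs.le (Real.abs_sin_le_one R)
      have h2 : Real.exp (-(R * s)) ≤ Real.exp (-s) := by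
        apply Real.exp_le_exp.2; nlinarith
      have h3 : (1 + s) * (1 + s ^ 2)⁻¹ ≤ 2 := by
        rw [← div_eq_mul_inv, div_le_iff₀ (by positivity)]
        nlinarith [sq_nonneg (s - 1)]
      rw [sub_mul, one_mul]
      refine (norm_sub_le _ _).trans (add_le_add (le_of_eq ?_) ?_)
      · exact Real.norm_of_nonneg (by positivity)
      · rw [norm_mul, norm_mul, Real.norm_of_nonneg (Real.exp_pos _).le,
          Real.norm_of_nonneg (show 0 ≤ (1 + s ^ 2)⁻¹ by positivity), Real.norm_eq_abs]
        calc _ ≤ Real.exp (-s) * (1 + s) * (1 + s ^ 2)⁻¹ := by gcongr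
          _ = Real.exp (-s) * ((1 + s) * (1 + s ^ 2)⁻¹) := by ring
          _ ≤ Real.exp (-s) * 2 := by gcongr
          _ = _ := by ring
    · filter_upwards [ae_restrict_mem measurableSet_Ioi] with s (hs : 0 < s)
      have h0 : Tendsto (fun R : ℝ => Real.exp (-(R * s))) atTop (𝓝 0) :=
        Real.tendsto_exp_neg_atTop_nhds_zero.comp (tendsto_id.atTop_mul_const hs)
      have h1 : Tendsto (fun R => Real.exp (-(R * s)) * (Real.cos R + s * Real.sin R)) atTop
          (𝓝 0) := by
        refine h0.zero_mul_isBoundedUnder_le ⟨1 + s, ?_⟩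
        rw [eventually_map]
        refine Eventually.of_forall fun R => ?_
        refine (abs_add_le _ _).trans (add_le_add (Real.abs_cos_le_one R) ?_)
        rw [abs_mul, abs_of_pos hs]
        exact mul_le_of_le_one_right hs.le (Real.abs_sin_le_one R)
      simpa using (h1.const_sub 1).mul_const (1 + s ^ 2)⁻¹
  rw [integral_Ioi_inv_one_add_sq, Real.arctan_zero, sub_zero] at hlim
  refine hlim.congr' ?_
  filter_upwards [eventually_ge_atTop 0] with R hR
  rw [integral_sinc_eq_integral_Ioi hR]

theorem integral_sinc_neg (u : ℝ) :
    ∫ t in (0 : ℝ)..(-u), Real.sinc t = -∫ t in (0 : ℝ)..u, Real.sinc t := by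
  have h := intervalIntegral.integral_comp_neg (a := 0) (b := u) Real.sinc
  simp only [Real.sinc_neg, neg_zero] at h
  rw [h, intervalIntegral.integral_symm]

theorem exists_abs_integral_sinc_le :
    ∃ C, ∀ u : ℝ, |∫ t in (0 : ℝ)..u, Real.sinc t| ≤ C := by
  obtain ⟨R, hR⟩ := eventually_atTop.1
    (tendsto_integral_sinc_atTop.abs.eventually_le_const (lt_add_one _))
  have hpos {u : ℝ} (hu : 0 ≤ u) :
      |∫ t in (0 : ℝ)..u, Real.sinc t| ≤ max R (|Real.pi / 2| + 1) := by
    rcases le_total R u with h | h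
    · exact (hR u h).trans (le_max_right _ _)
    · have := intervalIntegral.norm_integral_le_of_norm_le_const (a := 0) (b := u) (C := 1)
        (f := Real.sinc) fun x _ => Real.abs_sinc_le_one x
      rw [sub_zero, one_mul, abs_of_nonneg hu] at this
      exact this.trans (h.trans (le_max_left _ _))
  refine ⟨max R (|Real.pi / 2| + 1), fun u => ?_⟩
  rcases le_total 0 u with h | h
  · exact hpos h
  · rw [← abs_neg, ← integral_sinc_neg]
    exact hpos (neg_nonneg.2 h)

theorem tendsto_integral_sinc_mul_atTop (θ : ℝ) :
    Tendsto (fun R => ∫ t in (0 : ℝ)..(R * θ), Real.sinc t) atTop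
      (𝓝 (Real.pi / 2 * Real.sign θ)) := by
  rcases lt_trichotomy θ 0 with h | rfl | h
  · have := (tendsto_integral_sinc_atTop.comp
      (tendsto_id.atTop_mul_const (neg_pos.2 h))).neg
    simpa [Function.comp_def, integral_sinc_neg, Real.sign_of_neg h] using this
  · simp
  · have := tendsto_integral_sinc_atTop.comp (tendsto_id.atTop_mul_const h)
    simpa [Function.comp_def, Real.sign_of_pos h] using this

theorem measurable_real_sign : Measurable Real.sign :=
  Measurable.ite measurableSet_Iio measurable_const
    (Measurable.ite measurableSet_Ioi measurable_const measurable_const)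

theorem abs_real_sign_le_one (r : ℝ) : |Real.sign r| ≤ 1 := by
  rcases Real.sign_apply_eq r with h | h | h <;> simp [h]

theorem integrableOn_inv_smul {E : Type*} [NormedAddCommGroup E] [NormedSpace ℝ E]
    {ψ : ℝ → E} {ε : ℝ} {s : Set ℝ} (hε : 0 < ε) (hs : MeasurableSet s)
    (hle : ∀ t ∈ s, ε ≤ |t|) (hψ : Integrable ψ) : IntegrableOn (fun t => t⁻¹ • ψ t) s := by
  refine Integrable.bdd_smul (φ := fun t : ℝ => t⁻¹) hψ.integrableOn ε⁻¹ ?_ ?_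
  · exact measurable_inv.aestronglyMeasurable
  · filter_upwards [ae_restrict_mem hs] with t ht
    rw [norm_inv]
    exact inv_anti₀ hε (hle t ht)

theorem setIntegral_le_abs_eq_integral_Ioi {E : Type*} [NormedAddCommGroup E] [NormedSpace ℝ E]
    {h : ℝ → E} {ε : ℝ} (hε : 0 < ε) (hh : IntegrableOn h {t | ε ≤ |t|}) :
    ∫ t in {t : ℝ | ε ≤ |t|}, h t = ∫ t in Set.Ioi ε, (h t + h (-t)) := by
  have hset : {t : ℝ | ε ≤ |t|} = Set.Ici ε ∪ Set.Iic (-ε) := by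
    ext t
    simp only [Set.mem_ofPred_eq, le_abs, Set.mem_union, Set.mem_Ici, Set.mem_Iic]
    rw [le_neg]
  rw [hset] at hh ⊢
  have h1 : IntegrableOn h (Set.Ioi ε) := hh.left_of_union.mono_set Set.Ioi_subset_Ici_self
  have h2 : IntegrableOn (fun t => h (-t)) (Set.Ioi ε) := by
    have := hh.right_of_union.comp_neg
    simp only [Set.neg_Iic, neg_neg] at this
    exact this.mono_set Set.Ioi_subset_Ici_self
  have hdisj : Disjoint (Set.Ici ε) (Set.Iic (-ε)) := by
    rw [Set.disjoint_left]
    intro t ht ht'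
    simp only [Set.mem_Ici, Set.mem_Iic] at ht ht'
    linarith
  rw [setIntegral_union hdisj measurableSet_Iic hh.left_of_union hh.right_of_union,
    integral_Ici_eq_integral_Ioi, integral_add h1 h2]
  congr 1
  rw [← neg_neg ε, ← integral_comp_neg_Iic]
  simp

theorem integral_inv_mul_sin_mul (θ : ℝ) {ε R : ℝ} (hε : 0 < ε) (hR : ε ≤ R) :
    ∫ t in ε..R, t⁻¹ * Real.sin (t * θ) =
      (∫ t in (0 : ℝ)..(R * θ), Real.sinc t) - ∫ t in (0 : ℝ)..(ε * θ), Real.sinc t := by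
  have hi (a b : ℝ) : IntervalIntegrable Real.sinc volume a b :=
    Real.continuous_sinc.intervalIntegrable a b
  rw [intervalIntegral.integral_interval_sub_left (hi _ _) (hi _ _),
    ← intervalIntegral.mul_integral_comp_mul_right, ← intervalIntegral.integral_const_mul]
  refine intervalIntegral.integral_congr fun t ht => ?_
  rw [Set.uIcc_of_le hR] at ht
  have ht0 : t ≠ 0 := (hε.trans_le ht.1).ne'
  rcases eq_or_ne θ 0 with rfl | hθ
  · simp
  · simp only [Real.sinc_of_ne_zero (mul_ne_zero ht0 hθ)]
    field_simp

section Superposition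

variable {Ω : Type*} [MeasurableSpace Ω] {μ : Measure Ω} {k : Ω → ℂ} {θ : Ω → ℝ}

theorem integrable_mul_exp_mul_I (hk : Integrable k μ) (hθ : Measurable θ) (x : ℝ) :
    Integrable (fun ω => k ω * Complex.exp ((x * θ ω : ℝ) * Complex.I)) μ := by
  refine hk.mul_bdd (c := 1) ?_ (ae_of_all _ fun ω => ?_)
  · apply Measurable.aestronglyMeasurable; fun_prop
  · rw [Complex.norm_exp_ofReal_mul_I]

theorem integrable_mul_real_sign (hk : Integrable k μ) (hθ : Measurable θ) :
    Integrable (fun ω => k ω * (Real.sign (θ ω) : ℝ)) μ := by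
  refine hk.mul_bdd (c := 1) ?_ (ae_of_all _ fun ω => ?_)
  · exact (Complex.measurable_ofReal.comp (measurable_real_sign.comp hθ)).aestronglyMeasurable
  · rw [Complex.norm_real]
    exact abs_real_sign_le_one _

theorem integrable_mul_neg_I_mul_real_sign (hk : Integrable k μ) (hθ : Measurable θ) :
    Integrable (fun ω => k ω * (-Complex.I * (Real.sign (θ ω) : ℝ))) μ := by
  simpa only [mul_assoc] using integrable_mul_real_sign (hk.mul_const (-Complex.I)) hθ

theorem integral_inv_smul_superposition [SFinite μ] (hk : Integrable k μ) (hθ : Measurable θ)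
    {φ : ℝ → ℂ} (hφ : ∀ x, φ x = ∫ ω, k ω * Complex.exp ((x * θ ω : ℝ) * Complex.I) ∂μ)
    (x : ℝ) {ε R : ℝ} (hε : 0 < ε) (hR : ε ≤ R) :
    ∫ t in ε..R, t⁻¹ • (φ (x - t) - φ (x + t)) =
      ∫ ω, k ω * Complex.exp ((x * θ ω : ℝ) * Complex.I) * (-2 * Complex.I) *
        ((∫ t in (0 : ℝ)..(R * θ ω), Real.sinc t) -
          ∫ t in (0 : ℝ)..(ε * θ ω), Real.sinc t : ℝ) ∂μ := by
  have hexp (t a : ℝ) : Complex.exp (((x - t) * a : ℝ) * Complex.I) -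
      Complex.exp (((x + t) * a : ℝ) * Complex.I) =
      Complex.exp ((x * a : ℝ) * Complex.I) * (-2 * Complex.I) * (Real.sin (t * a) : ℝ) := by
    push_cast
    have h1 : ((x : ℂ) - t) * a * Complex.I = x * a * Complex.I + -(t * a) * Complex.I := by ring
    have h2 : ((x : ℂ) + t) * a * Complex.I = x * a * Complex.I + t * a * Complex.I := by ring
    rw [h1, h2, Complex.exp_add, Complex.exp_add, Complex.sin]
    linear_combination Complex.exp (x * a * Complex.I) *
      (Complex.exp (-(t * a) * Complex.I) - Complex.exp (t * a * Complex.I)) * Complex.I_sq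
  have hdiff (t : ℝ) : t⁻¹ • (φ (x - t) - φ (x + t)) = ∫ ω,
      k ω * Complex.exp ((x * θ ω : ℝ) * Complex.I) * (-2 * Complex.I) *
        (t⁻¹ * Real.sin (t * θ ω) : ℝ) ∂μ := by
    rw [hφ, hφ, ← integral_sub (integrable_mul_exp_mul_I hk hθ _)
      (integrable_mul_exp_mul_I hk hθ _), ← integral_smul]
    refine integral_congr_ae (ae_of_all _ fun ω => ?_)
    simp only [← mul_sub, hexp, Complex.real_smul]
    push_cast
    ring
  simp only [hdiff]
  rw [intervalIntegral_integral_swap]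
  · refine integral_congr_ae (ae_of_all _ fun ω => ?_)
    simp only
    rw [intervalIntegral.integral_const_mul, intervalIntegral.integral_ofReal,
      integral_inv_mul_sin_mul _ hε hR]
  · rw [Set.uIoc_of_le hR]
    have hk' : Integrable (fun p : ℝ × Ω => k p.2)
        ((volume.restrict (Set.Ioc ε R)).prod μ) := hk.comp_snd _
    have h1 := integrable_mul_exp_mul_I (θ := fun p : ℝ × Ω => θ p.2) hk' (by fun_prop) x
    refine (h1.mul_const (-2 * Complex.I)).mul_bdd (c := ε⁻¹) ?_ ?_
    · apply Measurable.aestronglyMeasurable; fun_prop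
    · have : ∀ᵐ p : ℝ × Ω ∂(volume.restrict (Set.Ioc ε R)).prod μ, p.1 ∈ Set.Ioc ε R :=
        Measure.quasiMeasurePreserving_fst.ae (ae_restrict_mem measurableSet_Ioc)
      filter_upwards [this] with p hp
      have hp0 : 0 < p.1 := hε.trans hp.1
      rw [Complex.norm_real, norm_mul, Real.norm_of_nonneg (inv_pos.2 hp0).le]
      calc _ ≤ p.1⁻¹ * 1 := by gcongr; exact Real.abs_sin_le_one _
        _ ≤ ε⁻¹ := by rw [mul_one]; gcongr; exact hp.1.le

theorem measurable_integral_sinc (a : ℝ) (hθ : Measurable θ) :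
    Measurable fun ω => ∫ t in (0 : ℝ)..(a * θ ω), Real.sinc t := by
  have : Continuous fun u => ∫ t in (0 : ℝ)..u, Real.sinc t :=
    intervalIntegral.continuous_primitive (fun a b =>
      Real.continuous_sinc.intervalIntegrable a b) 0
  exact this.measurable.comp (by fun_prop)

/-- The principal-value Hilbert transform of an integrable superposition of plane waves
`x ↦ exp (i θ x)` multiplies each wave by `-i sgn θ`. -/
theorem hasHilbert_of_superposition [SFinite μ] (hk : Integrable k μ) (hθ : Measurable θ)
    {φ : ℝ → ℂ} (hφ : ∀ x, φ x = ∫ ω, k ω * Complex.exp ((x * θ ω : ℝ) * Complex.I) ∂μ)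
    (hφi : Integrable φ) :
    HasHilbert φ fun x => ∫ ω, k ω * Complex.exp ((x * θ ω : ℝ) * Complex.I) *
      (-Complex.I * (Real.sign (θ ω) : ℝ)) ∂μ := by
  intro x
  obtain ⟨C, hC⟩ := exists_abs_integral_sinc_le
  have hkx := (integrable_mul_exp_mul_I hk hθ x).mul_const (-2 * Complex.I)
  have htrunc {ε : ℝ} (hε : 0 < ε) :
      ∫ y in {y : ℝ | ε ≤ |x - y|}, (x - y)⁻¹ • φ y =
        ∫ ω, k ω * Complex.exp ((x * θ ω : ℝ) * Complex.I) * (-2 * Complex.I) *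
          (Real.pi / 2 * Real.sign (θ ω) - ∫ t in (0 : ℝ)..(ε * θ ω), Real.sinc t : ℝ) ∂μ := by
    have hmeas : MeasurableSet {t : ℝ | ε ≤ |t|} :=
      measurableSet_le measurable_const measurable_id.abs
    have hint := integrableOn_inv_smul hε hmeas (fun _ h => h) (hφi.comp_sub_left x)
    have hpair := integrableOn_inv_smul hε measurableSet_Ioi
      (fun t (ht : ε < t) => ht.le.trans (le_abs_self t))
      ((hφi.comp_sub_left x).sub (hφi.comp_add_left x))
    have hcov : ∫ y in {y : ℝ | ε ≤ |x - y|}, (x - y)⁻¹ • φ y =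
        ∫ t in Set.Ioi ε, t⁻¹ • (φ (x - t) - φ (x + t)) := by
      have hmeas' : MeasurableSet {y : ℝ | ε ≤ |x - y|} :=
        measurableSet_le measurable_const (by fun_prop)
      rw [← integral_indicator hmeas', ← integral_sub_left_eq_self _ volume x]
      trans ∫ t in {t : ℝ | ε ≤ |t|}, t⁻¹ • φ (x - t)
      · rw [← integral_indicator hmeas]
        congr 1 with t
        simp [Set.indicator_apply]
      · rw [setIntegral_le_abs_eq_integral_Ioi hε hint]
        congr 1 with t
        rw [inv_neg, neg_smul, smul_sub, sub_neg_eq_add, ← sub_eq_add_neg]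
    rw [hcov]
    refine tendsto_nhds_unique
      (intervalIntegral_tendsto_integral_Ioi ε hpair tendsto_id) ?_
    refine Tendsto.congr' (f₁ := fun R => ∫ ω, k ω *
      Complex.exp ((x * θ ω : ℝ) * Complex.I) * (-2 * Complex.I) *
        ((∫ t in (0 : ℝ)..(R * θ ω), Real.sinc t) -
          ∫ t in (0 : ℝ)..(ε * θ ω), Real.sinc t : ℝ) ∂μ) ?_ ?_
    · filter_upwards [eventually_ge_atTop ε] with R hR
      exact (integral_inv_smul_superposition hk hθ hφ x hε hR).symm
    · refine tendsto_integral_filter_of_dominated_convergence _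
        (Eventually.of_forall fun R => ?_) (Eventually.of_forall fun R => ae_of_all _ fun ω => ?_)
        (hkx.norm.mul_const (C + C)) (ae_of_all _ fun ω => ?_)
      · refine hkx.aestronglyMeasurable.mul (Measurable.aestronglyMeasurable ?_)
        exact Complex.measurable_ofReal.comp
          ((measurable_integral_sinc R hθ).sub (measurable_integral_sinc ε hθ))
      · rw [norm_mul, Complex.norm_real]
        gcongr
        exact (norm_sub_le _ _).trans (add_le_add (hC _) (hC _))
      · exact (Complex.continuous_ofReal.tendsto _ |>.comp
          ((tendsto_integral_sinc_mul_atTop (θ ω)).sub_const _)).const_mul _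
  have hlim : Tendsto (fun ε : ℝ => ∫ ω, k ω *
      Complex.exp ((x * θ ω : ℝ) * Complex.I) * (-2 * Complex.I) *
        (Real.pi / 2 * Real.sign (θ ω) - ∫ t in (0 : ℝ)..(ε * θ ω), Real.sinc t : ℝ) ∂μ)
      (𝓝[>] 0) (𝓝 (∫ ω, k ω * Complex.exp ((x * θ ω : ℝ) * Complex.I) * (-2 * Complex.I) *
        (Real.pi / 2 * Real.sign (θ ω) : ℝ) ∂μ)) := by
    refine tendsto_integral_filter_of_dominated_convergence _
      (Eventually.of_forall fun R => ?_) (Eventually.of_forall fun R => ae_of_all _ fun ω => ?_)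
      (hkx.norm.mul_const (Real.pi / 2 + C)) (ae_of_all _ fun ω => ?_)
    · refine hkx.aestronglyMeasurable.mul (Measurable.aestronglyMeasurable ?_)
      exact Complex.measurable_ofReal.comp
        (((measurable_real_sign.comp hθ).const_mul _).sub (measurable_integral_sinc R hθ))
    · rw [norm_mul, Complex.norm_real]
      gcongr
      refine (norm_sub_le _ _).trans (add_le_add ?_ (hC _))
      rw [norm_mul, Real.norm_of_nonneg (by positivity)]
      exact mul_le_of_le_one_right (by positivity) (abs_real_sign_le_one _)
    · refine Tendsto.const_mul _ (Complex.continuous_ofReal.tendsto _ |>.comp ?_)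
      have hc : Continuous fun ε : ℝ => ∫ t in (0 : ℝ)..(ε * θ ω), Real.sinc t :=
        (intervalIntegral.continuous_primitive (fun a b =>
          Real.continuous_sinc.intervalIntegrable a b) 0).comp (by fun_prop)
      have h0 := (hc.tendsto 0).mono_left (nhdsWithin_le_nhds (s := Set.Ioi 0))
      simpa using h0.const_sub (Real.pi / 2 * Real.sign (θ ω))
  have hval : ∫ ω, k ω * Complex.exp ((x * θ ω : ℝ) * Complex.I) *
      (-Complex.I * (Real.sign (θ ω) : ℝ)) ∂μ =
      (Real.pi)⁻¹ • ∫ ω, k ω * Complex.exp ((x * θ ω : ℝ) * Complex.I) * (-2 * Complex.I) *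
        (Real.pi / 2 * Real.sign (θ ω) : ℝ) ∂μ := by
    rw [← integral_smul]
    refine integral_congr_ae (ae_of_all _ fun ω => ?_)
    have : (Real.pi : ℂ) ≠ 0 := Complex.ofReal_ne_zero.2 Real.pi_ne_zero
    simp only [Complex.real_smul]
    push_cast
    field_simp
  simp only [hval]
  refine (hlim.const_smul _).congr' ?_
  filter_upwards [self_mem_nhdsWithin] with ε hε
  rw [htrunc hε]

end Superposition

open scoped SchwartzMap FourierTransform

theorem schwartzMap_eq_integral_fourier (f : 𝓢(ℝ, ℂ)) (x : ℝ) :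
    f x = ∫ ξ, 𝓕 f ξ * Complex.exp ((x * (2 * Real.pi * ξ) : ℝ) * Complex.I) := by
  conv_lhs => rw [← FourierTransform.fourierInv_fourier_eq (F := 𝓢(ℝ, ℂ)) f, SchwartzMap.fourierInv_coe,
    Real.fourierInv_eq']
  congr 1 with ξ
  rw [smul_eq_mul, mul_comm]
  simp only [RCLike.inner_apply, conj_trivial]
  ring_nf

theorem integral_mul_real_sign {h : ℝ → ℂ} (hh : Integrable h) {c : ℝ} (hc : 0 < c) :
    ∫ ξ, h ξ * (Real.sign (c * ξ) : ℝ) = (∫ ξ in Set.Ioi 0, h ξ) - ∫ ξ in Set.Iic 0, h ξ := by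
  have hi := integrable_mul_real_sign hh (θ := fun ξ => c * ξ) (by fun_prop)
  rw [← intervalIntegral.integral_Iic_add_Ioi (b := 0) hi.integrableOn hi.integrableOn,
    integral_Iic_eq_integral_Iio, integral_Iic_eq_integral_Iio, add_comm, sub_eq_add_neg,
    ← integral_neg]
  congr 1
  · refine setIntegral_congr_fun measurableSet_Ioi fun ξ hξ => ?_
    simp [Real.sign_of_pos (mul_pos hc hξ)]
  · refine setIntegral_congr_fun measurableSet_Iio fun ξ hξ => ?_
    simp [Real.sign_of_neg (mul_neg_of_pos_of_neg hc hξ)]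

/-- The Hilbert transform of the Schwartz function with Fourier transform `u`. -/
def hilbertOfFourier (u : 𝓢(ℝ, ℂ)) (x : ℝ) : ℂ :=
  ∫ ξ, u ξ * Complex.exp ((x * (2 * Real.pi * ξ) : ℝ) * Complex.I) *
    (-Complex.I * (Real.sign (2 * Real.pi * ξ) : ℝ))

theorem integrable_mul_sign_symbol (u : 𝓢(ℝ, ℂ)) :
    Integrable fun ξ => u ξ * (-Complex.I * (Real.sign (2 * Real.pi * ξ) : ℝ)) :=
  integrable_mul_neg_I_mul_real_sign u.integrable (by fun_prop)

theorem hilbertOfFourier_eq (u : 𝓢(ℝ, ℂ)) (x : ℝ) :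
    hilbertOfFourier u x = ∫ ξ, u ξ * (-Complex.I * (Real.sign (2 * Real.pi * ξ) : ℝ)) *
      Complex.exp ((x * (2 * Real.pi * ξ) : ℝ) * Complex.I) := by
  unfold hilbertOfFourier
  congr 1 with ξ
  ring

theorem continuous_hilbertOfFourier (u : 𝓢(ℝ, ℂ)) : Continuous (hilbertOfFourier u) := by
  rw [funext (hilbertOfFourier_eq u)]
  have hu := integrable_mul_sign_symbol u
  refine continuous_of_dominated (fun x => ?_) (fun x => ae_of_all _ fun ξ => ?_) hu.norm
    (ae_of_all _ fun ξ => by fun_prop)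
  · exact (integrable_mul_exp_mul_I hu (by fun_prop) x).aestronglyMeasurable
  · rw [norm_mul, Complex.norm_exp_ofReal_mul_I, mul_one]

theorem exists_norm_hilbertOfFourier_le (u : 𝓢(ℝ, ℂ)) : ∃ C, ∀ x, ‖hilbertOfFourier u x‖ ≤ C := by
  refine ⟨∫ ξ, ‖u ξ * (-Complex.I * (Real.sign (2 * Real.pi * ξ) : ℝ))‖, fun x => ?_⟩
  rw [hilbertOfFourier_eq]
  refine (norm_integral_le_integral_norm _).trans_eq ?_
  congr 1 with ξ
  rw [norm_mul _ (Complex.exp _), Complex.norm_exp_ofReal_mul_I, mul_one]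

theorem mul_hilbertOfFourier_eq (u : 𝓢(ℝ, ℂ)) (x : ℝ) :
    (x * (2 * Real.pi) : ℝ) * hilbertOfFourier u x =
      2 * u 0 + ∫ ξ, deriv u ξ * Complex.exp ((x * (2 * Real.pi * ξ) : ℝ) * Complex.I) *
        (Real.sign (2 * Real.pi * ξ) : ℝ) := by
  have h2π : 0 < 2 * Real.pi := by positivity
  set e : ℝ → ℂ := fun ξ => Complex.exp ((x * (2 * Real.pi * ξ) : ℝ) * Complex.I) with he
  have hu' : Integrable (deriv u) := (SchwartzMap.derivCLM ℝ ℂ u).integrable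
  have hi1 : Integrable fun ξ => deriv u ξ * e ξ := integrable_mul_exp_mul_I hu' (by fun_prop) x
  have hi2 : Integrable fun ξ => u ξ * e ξ := integrable_mul_exp_mul_I u.integrable (by fun_prop) x
  set c : ℂ := (x * (2 * Real.pi) : ℝ) * Complex.I with hc
  have hi3 : Integrable fun ξ => deriv u ξ * e ξ + c * (u ξ * e ξ) := hi1.add (hi2.const_mul c)
  have hderiv (ξ : ℝ) : HasDerivAt (fun ξ => u ξ * e ξ)
      (deriv u ξ * e ξ + c * (u ξ * e ξ)) ξ := by
    have h1 : HasDerivAt (fun ξ : ℝ => ((x * (2 * Real.pi * ξ) : ℝ) : ℂ) * Complex.I) c ξ := by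
      have h := (((hasDerivAt_id ξ).const_mul (2 * Real.pi)).const_mul x).ofReal_comp.mul_const
        Complex.I
      refine h.congr_deriv ?_
      simp [hc]
    refine (u.differentiableAt.hasDerivAt.mul h1.cexp).congr_deriv ?_
    simp only [he]
    ring
  have hzero {l : Filter ℝ} (hl : l ≤ cocompact ℝ) : Tendsto (fun ξ => u ξ * e ξ) l (𝓝 0) := by
    rw [tendsto_zero_iff_norm_tendsto_zero]
    have := (u.tendsto_cocompact.mono_left hl).norm
    rw [norm_zero] at this
    refine this.congr fun ξ => ?_
    rw [norm_mul, he, Complex.norm_exp_ofReal_mul_I, mul_one]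
  have hIoi := integral_Ioi_of_hasDerivAt_of_tendsto' (a := 0) (fun ξ _ => hderiv ξ)
    hi3.integrableOn (hzero atTop_le_cocompact)
  have hIic := integral_Iic_of_hasDerivAt_of_tendsto' (a := 0) (fun ξ _ => hderiv ξ)
    hi3.integrableOn (hzero atBot_le_cocompact)
  have hsum := integral_mul_real_sign hi3 h2π
  have he0 : e 0 = 1 := by simp [he]
  rw [hIoi, hIic, he0] at hsum
  have hsplit : ∫ ξ, (deriv u ξ * e ξ + c * (u ξ * e ξ)) * (Real.sign (2 * Real.pi * ξ) : ℝ) =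
      (∫ ξ, deriv u ξ * e ξ * (Real.sign (2 * Real.pi * ξ) : ℝ)) -
        (x * (2 * Real.pi) : ℝ) * hilbertOfFourier u x := by
    have hb {h : ℝ → ℂ} (hh : Integrable h) :
        Integrable fun ξ => h ξ * (Real.sign (2 * Real.pi * ξ) : ℝ) :=
      integrable_mul_real_sign hh (by fun_prop)
    simp only [add_mul]
    rw [integral_add (hb hi1) (hb (hi2.const_mul c)), sub_eq_add_neg]
    congr 1
    rw [hilbertOfFourier, ← integral_const_mul, ← integral_neg]
    congr 1 with ξ
    simp only [hc, he]
    ring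
  rw [hsplit] at hsum
  linear_combination -hsum

theorem exists_abs_mul_norm_hilbertOfFourier_le (u : 𝓢(ℝ, ℂ)) :
    ∃ C, ∀ x, |x| * ‖hilbertOfFourier u x‖ ≤ C := by
  have hu' : Integrable (deriv u) := (SchwartzMap.derivCLM ℝ ℂ u).integrable
  refine ⟨(2 * ‖u 0‖ + ∫ ξ, ‖deriv u ξ‖) / (2 * Real.pi), fun x => ?_⟩
  have h2π : 0 < 2 * Real.pi := by positivity
  have h := congrArg norm (mul_hilbertOfFourier_eq u x)
  rw [norm_mul, Complex.norm_real, norm_mul, Real.norm_of_nonneg h2π.le, Real.norm_eq_abs] at h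
  have hle : ‖2 * u 0 + ∫ ξ, deriv u ξ *
      Complex.exp ((x * (2 * Real.pi * ξ) : ℝ) * Complex.I) *
        (Real.sign (2 * Real.pi * ξ) : ℝ)‖ ≤ 2 * ‖u 0‖ + ∫ ξ, ‖deriv u ξ‖ := by
    refine (norm_add_le _ _).trans (add_le_add (by simp) ?_)
    refine norm_integral_le_of_norm_le hu'.norm (ae_of_all _ fun ξ => ?_)
    rw [norm_mul, norm_mul, Complex.norm_exp_ofReal_mul_I, mul_one, Complex.norm_real]
    exact mul_le_of_le_one_right (norm_nonneg _) (abs_real_sign_le_one _)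
  rw [le_div_iff₀ h2π]
  linarith

theorem integrable_hilbertOfFourier_mul (u v : 𝓢(ℝ, ℂ)) :
    Integrable fun x => hilbertOfFourier u x * hilbertOfFourier v x := by
  obtain ⟨A, hA⟩ := exists_norm_hilbertOfFourier_le u
  obtain ⟨B, hB⟩ := exists_norm_hilbertOfFourier_le v
  obtain ⟨A', hA'⟩ := exists_abs_mul_norm_hilbertOfFourier_le u
  obtain ⟨B', hB'⟩ := exists_abs_mul_norm_hilbertOfFourier_le v
  refine (integrable_inv_one_add_sq.const_mul (A * B + A' * B')).mono'
    ((continuous_hilbertOfFourier u).mul (continuous_hilbertOfFourier v)).aestronglyMeasurable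
    (ae_of_all _ fun x => ?_)
  rw [← div_eq_mul_inv, le_div_iff₀ (by positivity), norm_mul]
  have h1 := mul_le_mul (hA x) (hB x) (norm_nonneg _) ((norm_nonneg _).trans (hA x))
  have h2 := mul_le_mul (hA' x) (hB' x) (by positivity) (le_trans (by positivity) (hA' x))
  have h3 : x ^ 2 = |x| * |x| := by rw [← sq, sq_abs]
  rw [h3]
  linarith

theorem hasHilbert_schwartzMap (f : 𝓢(ℝ, ℂ)) :
    HasHilbert (fun x => f x) (hilbertOfFourier (𝓕 f)) :=
  hasHilbert_of_superposition (𝓕 f).integrable (by fun_prop)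
    (schwartzMap_eq_integral_fourier f) f.integrable

theorem HasHilbert.unique {E : Type*} [NormedAddCommGroup E] [NormedSpace ℝ E]
    {f h₁ h₂ : ℝ → E} (H₁ : HasHilbert f h₁) (H₂ : HasHilbert f h₂) : h₁ = h₂ :=
  funext fun x => tendsto_nhds_unique (H₁ x) (H₂ x)

theorem integral_mul_exp_mul_integral_mul_exp (k l : ℝ → ℂ) (x : ℝ) :
    (∫ ξ, k ξ * Complex.exp ((x * (2 * Real.pi * ξ) : ℝ) * Complex.I)) *
      (∫ η, l η * Complex.exp ((x * (2 * Real.pi * η) : ℝ) * Complex.I)) =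
    ∫ p : ℝ × ℝ, k p.1 * l p.2 *
      Complex.exp ((x * (2 * Real.pi * (p.1 + p.2)) : ℝ) * Complex.I) := by
  rw [← integral_prod_mul, Measure.volume_eq_prod]
  congr 1 with p
  have : ((x * (2 * Real.pi * (p.1 + p.2)) : ℝ) : ℂ) * Complex.I =
      (x * (2 * Real.pi * p.1) : ℝ) * Complex.I + (x * (2 * Real.pi * p.2) : ℝ) * Complex.I := by
    push_cast
    ring
  rw [this, Complex.exp_add]
  ring

/-- The symbol identity behind Cotlar's identity. -/
theorem real_sign_add_mul (a b : ℝ) :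
    Real.sign (a + b) * (1 + Real.sign a * Real.sign b) = Real.sign a + Real.sign b := by
  rcases lt_trichotomy a 0 with ha | rfl | ha <;> rcases lt_trichotomy b 0 with hb | rfl | hb
  · rw [Real.sign_of_neg ha, Real.sign_of_neg hb, Real.sign_of_neg (add_neg ha hb)]; norm_num
  · simp
  · rw [Real.sign_of_neg ha, Real.sign_of_pos hb]; norm_num
  · simp
  · simp
  · simp
  · rw [Real.sign_of_pos ha, Real.sign_of_neg hb]; norm_num
  · simp
  · rw [Real.sign_of_pos ha, Real.sign_of_pos hb, Real.sign_of_pos (add_pos ha hb)]; norm_num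

/-- **Cotlar's identity.**  For Schwartz functions `f, g : ℝ → ℂ` one has
`H(fg) = (Hf)·g + f·(Hg) + H((Hf)·(Hg))`. -/
theorem cotlar_identity
    (f g : SchwartzMap ℝ ℂ) (Hf Hg Hfg Hprod : ℝ → ℂ)
    (hHf : HasHilbert (fun x => f x) Hf)
    (hHg : HasHilbert (fun x => g x) Hg)
    (hHfg : HasHilbert (fun x => f x * g x) Hfg)
    (hHprod : HasHilbert (fun x => Hf x * Hg x) Hprod) :
    ∀ x : ℝ, Hfg x = Hf x * g x + f x * Hg x + Hprod x := by
  intro x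
  obtain rfl := hHf.unique (hasHilbert_schwartzMap f)
  obtain rfl := hHg.unique (hasHilbert_schwartzMap g)
  have hu := integrable_mul_sign_symbol (𝓕 f)
  have hv := integrable_mul_sign_symbol (𝓕 g)
  have huv : Integrable fun p : ℝ × ℝ => 𝓕 f p.1 * 𝓕 g p.2 :=
    (𝓕 f).integrable.mul_prod (𝓕 g).integrable
  have huv' : Integrable fun p : ℝ × ℝ =>
      𝓕 f p.1 * (-Complex.I * (Real.sign (2 * Real.pi * p.1) : ℝ)) *
        (𝓕 g p.2 * (-Complex.I * (Real.sign (2 * Real.pi * p.2) : ℝ))) := hu.mul_prod hv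
  have hθ : Measurable fun p : ℝ × ℝ => 2 * Real.pi * (p.1 + p.2) := by fun_prop
  have hfg_int : Integrable fun x => f x * g x := by
    obtain ⟨C, hC⟩ := g.decay 0 0
    refine f.integrable.mul_bdd (c := C) g.continuous.aestronglyMeasurable (ae_of_all _ fun x => ?_)
    simpa using hC.2 x
  have hfg := hHfg.unique <| hasHilbert_of_superposition huv hθ
    (fun x => by
      rw [schwartzMap_eq_integral_fourier f, schwartzMap_eq_integral_fourier g,
        integral_mul_exp_mul_integral_mul_exp]) hfg_int
  have hprod := hHprod.unique <| hasHilbert_of_superposition huv' hθ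
    (fun x => by
      rw [hilbertOfFourier_eq, hilbertOfFourier_eq, integral_mul_exp_mul_integral_mul_exp])
    (integrable_hilbertOfFourier_mul _ _)
  have hsymb {k : ℝ × ℝ → ℂ} (hk : Integrable k) : Integrable fun p : ℝ × ℝ =>
      k p * Complex.exp ((x * (2 * Real.pi * (p.1 + p.2)) : ℝ) * Complex.I) *
        (-Complex.I * (Real.sign (2 * Real.pi * (p.1 + p.2)) : ℝ)) :=
    integrable_mul_neg_I_mul_real_sign (integrable_mul_exp_mul_I hk hθ x) hθ
  rw [hfg, hprod]
  beta_reduce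
  rw [← sub_eq_iff_eq_add, ← integral_sub (hsymb huv) (hsymb huv'), schwartzMap_eq_integral_fourier f,
    schwartzMap_eq_integral_fourier g, hilbertOfFourier_eq, hilbertOfFourier_eq,
    integral_mul_exp_mul_integral_mul_exp, integral_mul_exp_mul_integral_mul_exp,
    ← integral_add (integrable_mul_exp_mul_I (μ := volume) (hu.mul_prod (𝓕 g).integrable) hθ x)
      (integrable_mul_exp_mul_I (μ := volume) ((𝓕 f).integrable.mul_prod hv) hθ x)]
  congr 1 with p
  have hs := congrArg (fun r : ℝ => (r : ℂ))
    (real_sign_add_mul (2 * Real.pi * p.1) (2 * Real.pi * p.2))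
  simp only [← mul_add] at hs
  push_cast at hs ⊢
  linear_combination (-Complex.I) * 𝓕 f p.1 * 𝓕 g p.2 *
    Complex.exp (x * (2 * Real.pi * (p.1 + p.2)) * Complex.I) * hs
    + 𝓕 f p.1 * 𝓕 g p.2 * Complex.exp (x * (2 * Real.pi * (p.1 + p.2)) * Complex.I) * Complex.I *
      (Real.sign (2 * Real.pi * (p.1 + p.2)) : ℝ) * (Real.sign (2 * Real.pi * p.1) : ℝ) *
      (Real.sign (2 * Real.pi * p.2) : ℝ) * Complex.I_sq
end
end
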